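/- arXiv:1207.4719 — 6 statements merged into one kernel-verified Lean document; each statement's English description precedes it below -/
import Mathlib

section
/- Let Λ = (λ_k)_{k≥1} be a lacunary sequence of positive reals with ∑_k 1/λ_k < ∞. Let φ : [0,1] → [0,1] be Borel measurable with ess sup_{[0,1]} φ = 1, with finite set of essential points of maximum 𝔐_φ = {x_1, …, x_k}, and φ(x_i) = 1 for each i. Assume that for each i: if x_i > 0 then liminf_{t→x_i⁻} (φ(x_i) − φ(t))/(x_i − t) > 0, and if x_i < 1 then limsup_{t→x_i⁺} (φ(x_i) − φ(t))/(x_i − t) < 0. Then C_φ : M²_Λ → L²([0,1]) is bounded: there exists C > 0 such that ∫₀¹ |g(φ(x))|² dx ≤ C² ∫₀¹ |g(x)|² dx for every g in the linear span of the monomials x ↦ x^{λ_k}. -/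
open MeasureTheory Filter

/-- Lebesgue measure restricted to the unit interval `[0,1]`. -/
noncomputable def m01 : Measure ℝ := volume.restrict (Set.Icc (0 : ℝ) 1)

/-- `g` belongs to the linear span of the monomials `x ↦ x^{Λ k}`. -/
def inSpan (Λ : ℕ → ℝ) (g : ℝ → ℝ) : Prop :=
  ∃ (n : ℕ) (c : Fin n → ℝ) (k : Fin n → ℕ),
    ∀ x : ℝ, g x = ∑ i, c i * x ^ (Λ (k i))

/-- The essential supremum of `φ` over the subset `s` of `[0,1]`, with respect to
Lebesgue measure, computed in `EReal`. -/
noncomputable def essSupOn (φ : ℝ → ℝ) (s : Set ℝ) : EReal :=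
  essSup (fun x => ((φ x : ℝ) : EReal)) (m01.restrict s)

/-- The set `𝔐_φ` of essential points of maximum of `φ`. -/
def essMaxPts (φ : ℝ → ℝ) : Set ℝ :=
  {x | x ∈ Set.Icc (0 : ℝ) 1 ∧
    ∀ E ∈ nhdsWithin x (Set.Icc (0 : ℝ) 1), essSupOn φ E = essSupOn φ Set.univ}


lemma aux_geom (μ : ℕ → ℝ) (γ : ℝ) (hγ : 1 < γ)
    (hl : ∀ k, γ * μ k ≤ μ (k+1)) (j d : ℕ) : γ ^ d * μ j ≤ μ (j + d) := by
  induction d with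
  | zero => simp
  | succ d ih =>
    calc γ ^ (d+1) * μ j = γ * (γ ^ d * μ j) := by ring
      _ ≤ γ * μ (j+d) := by gcongr
      _ ≤ _ := hl _

lemma aux_kernel (a b θ : ℝ) (ha : 0 < a) (hb : 0 < b) (h0 : 0 < θ)
    (h : a ≤ θ ^ 2 * b) : √a * √b / (a + b) ≤ θ := by
  have h1 : √a ≤ θ * √b := by
    calc √a ≤ √(θ^2 * b) := Real.sqrt_le_sqrt h
      _ = θ * √b := by rw [Real.sqrt_mul (by positivity), Real.sqrt_sq h0.le]
  rw [div_le_iff₀ (by positivity)]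
  have h2 := Real.mul_self_sqrt hb.le
  nlinarith [Real.sqrt_nonneg b, mul_pos h0 ha, mul_le_mul_of_nonneg_right h1 (Real.sqrt_nonneg b)]

lemma aux_schur (μ : ℕ → ℝ) (hμ : ∀ k, 0 < μ k) (γ : ℝ) (hγ : 1 < γ)
    (hl : ∀ k, γ * μ k ≤ μ (k+1)) :
    ∃ S : ℝ, 0 < S ∧ ∀ (n : ℕ) (c : ℕ → ℝ),
      ∑ j ∈ Finset.range n, ∑ k ∈ Finset.range n, |c j| * |c k| / (μ j + μ k)
        ≤ S * ∑ j ∈ Finset.range n, c j ^ 2 / μ j := by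
  set θ : ℝ := (√γ)⁻¹ with hθ
  have hg1 : 1 < √γ := by rw [Real.lt_sqrt (by norm_num)]; simpa using hγ
  have h0 : 0 < θ := by positivity
  have h1 : θ < 1 := inv_lt_one_of_one_lt₀ hg1
  have hθ2 : θ ^ 2 = γ⁻¹ := by rw [hθ, inv_pow, Real.sq_sqrt (by linarith)]
  have hs : Summable (fun z : ℤ => θ ^ z.natAbs) := by
    apply Summable.of_nat_of_neg
    · simpa using summable_geometric_of_lt_one h0.le h1
    · simpa using summable_geometric_of_lt_one h0.le h1
  have hker0 : ∀ j d : ℕ, √(μ j) * √(μ (j+d)) / (μ j + μ (j+d)) ≤ θ ^ d := by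
    intro j d
    apply aux_kernel _ _ _ (hμ _) (hμ _) (by positivity)
    have := aux_geom μ γ hγ hl j d
    rw [← pow_mul, mul_comm d 2, pow_mul, hθ2, inv_pow, inv_mul_eq_div, le_div_iff₀ (by positivity)]
    linarith
  have hker : ∀ j k : ℕ, √(μ j) * √(μ k) / (μ j + μ k) ≤ θ ^ ((j:ℤ) - k).natAbs := by
    intro j k
    rcases le_total j k with h | h
    · obtain ⟨d, rfl⟩ := Nat.exists_eq_add_of_le h
      have := hker0 j d
      have e : ((j:ℤ) - ((j+d : ℕ):ℤ)).natAbs = d := by omega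
      rwa [e]
    · obtain ⟨d, rfl⟩ := Nat.exists_eq_add_of_le h
      have := hker0 k d
      have e : (((k+d : ℕ):ℤ) - (k:ℤ)).natAbs = d := by omega
      rw [e, mul_comm, add_comm (μ _)]; exact this
  set S := ∑' z : ℤ, θ ^ z.natAbs with hS
  have hrow : ∀ n j : ℕ, ∑ k ∈ Finset.range n, θ ^ ((j:ℤ) - k).natAbs ≤ S := by
    intro n j
    have hinj : Function.Injective (fun k : ℕ => (j:ℤ) - k) := by
      intro a b h; simp at h; exact h
    have := hs.sum_le_tsum ((Finset.range n).map ⟨_, hinj⟩) (fun z _ => by positivity)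
    simpa using this
  have hSpos : 0 < S := by
    have := hrow 1 0
    simp at this; linarith
  refine ⟨S, hSpos, fun n c => ?_⟩
  have hterm : ∀ j k : ℕ, |c j| * |c k| / (μ j + μ k) ≤
      (c j ^ 2 / μ j * θ ^ ((j:ℤ) - k).natAbs) / 2 + (c k ^ 2 / μ k * θ ^ ((k:ℤ) - j).natAbs) / 2 := by
    intro j k
    have e : ((k:ℤ) - j).natAbs = ((j:ℤ) - k).natAbs := by omega
    rw [e]
    have hj := Real.sqrt_pos.2 (hμ j)
    have hk := Real.sqrt_pos.2 (hμ k)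
    set a := |c j| / √(μ j) with ha
    set b := |c k| / √(μ k) with hb
    have ha2 : c j ^ 2 / μ j = a ^ 2 := by rw [ha, div_pow, sq_abs, Real.sq_sqrt (hμ j).le]
    have hb2 : c k ^ 2 / μ k = b ^ 2 := by rw [hb, div_pow, sq_abs, Real.sq_sqrt (hμ k).le]
    have e2 : |c j| * |c k| / (μ j + μ k) = a * b * (√(μ j) * √(μ k) / (μ j + μ k)) := by
      rw [ha, hb]; field_simp
    rw [e2, ha2, hb2]
    have ha0 : 0 ≤ a := by positivity
    have hb0 : 0 ≤ b := by positivity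
    have := mul_le_mul_of_nonneg_left (hker j k) (mul_nonneg ha0 hb0)
    have hp : 0 < θ ^ ((j:ℤ) - k).natAbs := by positivity
    nlinarith [mul_nonneg hp.le (sq_nonneg (a-b))]
  calc _ ≤ ∑ j ∈ Finset.range n, ∑ k ∈ Finset.range n, ((c j ^ 2 / μ j * θ ^ ((j:ℤ) - k).natAbs) / 2 + (c k ^ 2 / μ k * θ ^ ((k:ℤ) - j).natAbs) / 2) :=
        Finset.sum_le_sum fun j _ => Finset.sum_le_sum fun k _ => hterm j k
    _ = ∑ j ∈ Finset.range n, ∑ k ∈ Finset.range n, (c j ^ 2 / μ j * θ ^ ((j:ℤ) - k).natAbs) := by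
        simp only [Finset.sum_add_distrib]
        rw [Finset.sum_comm (f := fun j k : ℕ => (c k ^ 2 / μ k * θ ^ ((k:ℤ) - j).natAbs) / 2)]
        simp only [← Finset.sum_div]
        ring
    _ ≤ ∑ j ∈ Finset.range n, c j ^ 2 / μ j * S := by
        apply Finset.sum_le_sum; intro j _
        rw [← Finset.mul_sum]
        have := hμ j
        gcongr
        exact hrow n j
    _ = _ := by rw [← Finset.sum_mul, mul_comm]

lemma aux_int_exp (a : ℝ) (ha : 0 < a) : ∫ t in Set.Ioi (0:ℝ), Real.exp (-a * t) = 1 / a := by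
  have := integral_exp_mul_Ioi (a := -a) (by linarith) 0
  rw [this]; simp

lemma aux_intble_exp (a : ℝ) (ha : 0 < a) : IntegrableOn (fun t => Real.exp (-a * t)) (Set.Ioi (0:ℝ)) :=
  integrableOn_exp_mul_Ioi (by linarith) 0

lemma aux_q (ρ0 : ℝ) (h1 : 1 < ρ0) : ∃ ρ : ℝ, 0 < ρ ∧ ρ < 1 ∧ ∀ t : ℝ, 0 < t → ∀ r, ρ0 ≤ r →
    (4 * Real.exp (-t) * (1 - Real.exp (-t))) * (4 * Real.exp (-(r*t)) * (1 - Real.exp (-(r*t)))) ≤ ρ := by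
  set w := √ρ0 with hw
  have hw1 : 1 < w := by rw [hw, Real.lt_sqrt (by norm_num)]; simpa using h1
  have hww : w * w = ρ0 := Real.mul_self_sqrt (by linarith)
  have hL : 0 < Real.log 2 := Real.log_pos (by norm_num)
  have hE : Real.exp (-Real.log 2) = 1/2 := by rw [Real.exp_neg, Real.exp_log (by norm_num)]; norm_num
  set y1 := Real.exp (-(Real.log 2 / w)) with hy1
  set y2 := Real.exp (-(Real.log 2 * w)) with hy2
  have b1 : 1/2 < y1 := by
    rw [← hE, hy1, Real.exp_lt_exp]
    have : Real.log 2 / w < Real.log 2 := div_lt_self hL hw1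
    linarith
  have b2 : y2 < 1/2 := by
    rw [← hE, hy2, Real.exp_lt_exp]
    nlinarith
  have b11 : y1 < 1 := by rw [hy1, Real.exp_lt_one_iff]; have : 0 < Real.log 2 / w := by positivity
                          linarith
  have b20 : 0 < y2 := Real.exp_pos _
  refine ⟨max (4*y1*(1-y1)) (4*y2*(1-y2)), ?_, ?_, ?_⟩
  · apply lt_max_of_lt_left; apply mul_pos <;> linarith
  · apply max_lt <;> nlinarith
  · intro t ht r hr
    have hrt : 0 < r * t := by apply mul_pos <;> linarith
    have le1 : ∀ y : ℝ, 4 * y * (1-y) ≤ 1 := fun y => by nlinarith [sq_nonneg (2*y-1)]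
    have ge0 : ∀ s : ℝ, 0 < s → 0 ≤ 4 * Real.exp (-s) * (1 - Real.exp (-s)) := fun s hs => by
      have : Real.exp (-s) < 1 := by rw [Real.exp_lt_one_iff]; linarith
      have := Real.exp_pos (-s)
      apply mul_nonneg <;> linarith
    rcases le_total t (Real.log 2 / w) with h | h
    · have : y1 ≤ Real.exp (-t) := by rw [hy1, Real.exp_le_exp]; linarith
      refine le_trans ?_ (le_max_left _ _)
      refine le_trans (mul_le_of_le_one_right (ge0 t ht) (le1 _)) ?_
      nlinarith
    · have : Real.exp (-(r*t)) ≤ y2 := by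
        rw [hy2, Real.exp_le_exp]
        have h3 : Real.log 2 ≤ t * w := by rwa [div_le_iff₀ (by linarith)] at h
        nlinarith
      refine le_trans ?_ (le_max_right _ _)
      refine le_trans (mul_le_of_le_one_left (ge0 _ hrt) (le1 _)) ?_
      nlinarith

lemma aux_q2 (ρ : ℝ) (h1 : ρ < 1) : ∃ σ a b : ℝ, ρ < σ ∧ σ < 1 ∧ 0 < a ∧ a < b ∧
    ∀ t ∈ Set.Ioo a b, σ ≤ (4 * Real.exp (-t) * (1 - Real.exp (-t))) ^ 2 := by
  obtain ⟨σ, hσ, hσ1⟩ := exists_between h1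
  have hc : Continuous fun t : ℝ => (4 * Real.exp (-t) * (1 - Real.exp (-t))) ^ 2 := by fun_prop
  have hE : Real.exp (-Real.log 2) = 1/2 := by rw [Real.exp_neg, Real.exp_log (by norm_num)]; norm_num
  have hL : 0 < Real.log 2 := Real.log_pos (by norm_num)
  have hv : σ < (4 * Real.exp (-Real.log 2) * (1 - Real.exp (-Real.log 2))) ^ 2 := by
    rw [hE]; norm_num; exact hσ1
  have := (hc.tendsto (Real.log 2)).eventually (lt_mem_nhds hv)
  obtain ⟨ε, hε, hball⟩ := Metric.eventually_nhds_iff.1 this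
  refine ⟨σ, Real.log 2, Real.log 2 + ε, hσ, hσ1, hL, by linarith, fun t ht => (hball ?_).le⟩
  rw [Real.dist_eq, abs_lt]; constructor <;> linarith [ht.1, ht.2]

noncomputable def auxq (t : ℝ) : ℝ := 4 * Real.exp (-t) * (1 - Real.exp (-t))

lemma auxq_cont : Continuous auxq := by unfold auxq; fun_prop

lemma auxq_nonneg (t : ℝ) (ht : 0 ≤ t) : 0 ≤ auxq t := by
  have : Real.exp (-t) ≤ 1 := by rw [Real.exp_le_one_iff]; linarith
  have := Real.exp_pos (-t)
  unfold auxq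
  apply mul_nonneg <;> linarith

lemma auxq_le_one (t : ℝ) : auxq t ≤ 1 := by
  unfold auxq; nlinarith [sq_nonneg (2*Real.exp (-t)-1)]

lemma auxq_le_exp (t : ℝ) : auxq t ≤ 4 * Real.exp (-t) := by
  unfold auxq; nlinarith [Real.exp_pos (-t)]

lemma auxq_prod_le (a b t ρ : ℝ) (ha : 0 < a) (hb : 0 < b) (ht : 0 < t) (N : ℕ)
    (h : auxq (a*t) * auxq (b*t) ≤ ρ) :
    auxq (a*t) ^ (N+1) * auxq (b*t) ^ (N+1) ≤ 16 * ρ ^ N * Real.exp (-(a+b)*t) := by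
  have h1 := auxq_nonneg (a*t) (by positivity)
  have h2 := auxq_nonneg (b*t) (by positivity)
  have h3 := auxq_le_exp (a*t)
  have h4 := auxq_le_exp (b*t)
  have h5 : 0 ≤ ρ := le_trans (mul_nonneg h1 h2) h
  calc _ = (auxq (a*t) * auxq (b*t)) ^ N * (auxq (a*t) * auxq (b*t)) := by ring
    _ ≤ ρ ^ N * ((4 * Real.exp (-(a*t))) * (4 * Real.exp (-(b*t)))) := by gcongr
    _ = 16 * ρ ^ N * (Real.exp (-(a*t)) * Real.exp (-(b*t))) := by ring
    _ = _ := by rw [← Real.exp_add]; ring_nf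

lemma auxq_intble (a b : ℝ) (ha : 0 < a) (hb : 0 < b) (N : ℕ) :
    IntegrableOn (fun t => auxq (a*t) ^ (N+1) * auxq (b*t) ^ (N+1)) (Set.Ioi (0:ℝ)) := by
  refine Integrable.mono' ((aux_intble_exp (a+b) (by positivity)).const_mul 16) ?_ ?_
  · apply Continuous.aestronglyMeasurable
    have := auxq_cont
    fun_prop
  · filter_upwards [ae_restrict_mem measurableSet_Ioi] with t ht
    have ht : 0 < t := ht
    have h1 := auxq_nonneg (a*t) (by positivity)
    have h2 := auxq_nonneg (b*t) (by positivity)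
    rw [Real.norm_of_nonneg (by positivity)]
    have := auxq_prod_le a b t 1 ha hb ht N (mul_le_one₀ (auxq_le_one _) h2 (auxq_le_one _))
    simpa using this

lemma auxF_sq (μ : ℕ → ℝ) (n : ℕ) (c : ℕ → ℝ) (t : ℝ) :
    (∑ j ∈ Finset.range n, c j * Real.exp (-(μ j * t))) ^ 2 =
      ∑ j ∈ Finset.range n, ∑ k ∈ Finset.range n, c j * c k * Real.exp (-(μ j + μ k) * t) := by
  rw [sq, Finset.sum_mul_sum]
  refine Finset.sum_congr rfl fun j _ => Finset.sum_congr rfl fun k _ => ?_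
  rw [show -(μ j + μ k) * t = -(μ j * t) + -(μ k * t) by ring, Real.exp_add]; ring

lemma auxF_intble (μ : ℕ → ℝ) (hμ : ∀ k, 0 < μ k) (n : ℕ) (c : ℕ → ℝ) (s : ℝ) (hs : 0 < s) :
    IntegrableOn (fun t => (∑ j ∈ Finset.range n, c j * Real.exp (-(μ j * (s * t)))) ^ 2) (Set.Ioi (0:ℝ)) := by
  have : (fun t => (∑ j ∈ Finset.range n, c j * Real.exp (-(μ j * (s * t)))) ^ 2) =
      fun t => ∑ j ∈ Finset.range n, ∑ k ∈ Finset.range n, c j * c k * Real.exp (-(s * (μ j + μ k)) * t) := by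
    ext t; rw [auxF_sq]
    refine Finset.sum_congr rfl fun j _ => Finset.sum_congr rfl fun k _ => ?_
    ring_nf
  rw [this]
  refine integrable_finsetSum _ fun j _ => integrable_finsetSum _ fun k _ => ?_
  exact (aux_intble_exp _ (mul_pos hs (add_pos (hμ j) (hμ k)))).const_mul _

lemma auxF_int (μ : ℕ → ℝ) (hμ : ∀ k, 0 < μ k) (n : ℕ) (c : ℕ → ℝ) (s : ℝ) (hs : 0 < s) :
    ∫ t in Set.Ioi (0:ℝ), (∑ j ∈ Finset.range n, c j * Real.exp (-(μ j * (s * t)))) ^ 2 =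
      (1 / s) * ∑ j ∈ Finset.range n, ∑ k ∈ Finset.range n, c j * c k / (μ j + μ k) := by
  have : (fun t => (∑ j ∈ Finset.range n, c j * Real.exp (-(μ j * (s * t)))) ^ 2) =
      fun t => ∑ j ∈ Finset.range n, ∑ k ∈ Finset.range n, c j * c k * Real.exp (-(s * (μ j + μ k)) * t) := by
    ext t; rw [auxF_sq]
    refine Finset.sum_congr rfl fun j _ => Finset.sum_congr rfl fun k _ => ?_
    ring_nf
  rw [this]
  have hi : ∀ j k, IntegrableOn (fun t => c j * c k * Real.exp (-(s * (μ j + μ k)) * t)) (Set.Ioi (0:ℝ)) :=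
    fun j k => (aux_intble_exp _ (mul_pos hs (add_pos (hμ j) (hμ k)))).const_mul _
  rw [integral_finsetSum _ fun j _ => integrable_finsetSum _ fun k _ => hi j k, Finset.mul_sum]
  refine Finset.sum_congr rfl fun j _ => ?_
  rw [integral_finsetSum _ fun k _ => hi j k, Finset.mul_sum]
  refine Finset.sum_congr rfl fun k _ => ?_
  have := add_pos (hμ j) (hμ k)
  rw [integral_const_mul, aux_int_exp _ (by positivity)]
  field_simp

lemma auxq_poly (N : ℕ) : ∃ (d : ℕ) (r : ℕ → ℝ), ∀ t : ℝ,
    auxq t ^ (N+1) = ∑ m ∈ Finset.range d, r m * Real.exp (-(((m:ℝ)+1) * t)) := by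
  let R : Polynomial ℝ := 4 * (1 - Polynomial.X) * (4 * Polynomial.X * (1 - Polynomial.X)) ^ N
  refine ⟨R.natDegree + 1, fun m => R.coeff m, fun t => ?_⟩
  have h : auxq t ^ (N+1) = R.eval (Real.exp (-t)) * Real.exp (-t) := by
    simp [R, auxq]; ring
  rw [h, Polynomial.eval_eq_sum_range, Finset.sum_mul]
  refine Finset.sum_congr rfl fun m _ => ?_
  rw [← Real.exp_nat_mul, mul_assoc, ← Real.exp_add]
  ring_nf

set_option maxHeartbeats 2000000 in
lemma aux_lower (μ : ℕ → ℝ) (hμ : ∀ k, 0 < μ k) (γ : ℝ) (hγ : 1 < γ)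
    (hl : ∀ k, γ * μ k ≤ μ (k+1)) :
    ∃ B : ℝ, 0 < B ∧ ∀ (n : ℕ) (c : ℕ → ℝ),
      ∑ j ∈ Finset.range n, c j ^ 2 / μ j ≤
      B * ∑ j ∈ Finset.range n, ∑ k ∈ Finset.range n, c j * c k / (μ j + μ k) := by
  obtain ⟨S, hS, hschur⟩ := aux_schur μ hμ γ hγ hl
  obtain ⟨ρ, hρ0, hρ1, hρ⟩ := aux_q γ hγ
  obtain ⟨σ, a, b, hρσ, hσ1, ha, hab, hσ⟩ := aux_q2 ρ hρ1
  have hσ0 : 0 < σ := hρ0.trans hρσ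
  -- choice of N
  obtain ⟨N, hN⟩ : ∃ N : ℕ, 32 * S * ρ ^ N ≤ σ ^ (N+1) * (b - a) := by
    have h1 : Tendsto (fun N : ℕ => 32 * S * (ρ/σ) ^ N) atTop (nhds (32 * S * 0)) :=
      (tendsto_pow_atTop_nhds_zero_of_lt_one (by positivity) ((div_lt_one hσ0).2 hρσ)).const_mul _
    have h2 : (32 * S * 0 : ℝ) < σ * (b-a) := by
      have : 0 < b - a := by linarith
      rw [mul_zero]; positivity
    obtain ⟨N, hN⟩ := (h1.eventually (gt_mem_nhds h2)).exists
    refine ⟨N, ?_⟩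
    rw [div_pow] at hN
    have hp : 0 < σ ^ N := by positivity
    have := mul_le_mul_of_nonneg_right hN.le hp.le
    have e : 32 * S * (ρ ^ N / σ ^ N) * σ ^ N = 32 * S * ρ ^ N := by field_simp
    rw [e] at this
    rw [pow_succ]; linarith
  obtain ⟨d, r, hr⟩ := auxq_poly N
  set A := ∫ t in Set.Ioi (0:ℝ), auxq t ^ (N+1) * auxq t ^ (N+1) with hA
  have hAint : IntegrableOn (fun t => auxq t ^ (N+1) * auxq t ^ (N+1)) (Set.Ioi (0:ℝ)) := by
    simpa using auxq_intble 1 1 one_pos one_pos N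
  have hAlow : σ ^ (N+1) * (b - a) ≤ A := by
    have hsub : Set.Ioo a b ⊆ Set.Ioi 0 := fun t ht => ha.trans ht.1
    calc σ ^ (N+1) * (b - a) = ∫ t in Set.Ioo a b, σ ^ (N+1) := by
          simp [hab.le, mul_comm]
      _ ≤ ∫ t in Set.Ioo a b, auxq t ^ (N+1) * auxq t ^ (N+1) := by
          apply setIntegral_mono_on (by simp) (hAint.mono_set hsub) measurableSet_Ioo
          intro t ht
          have := hσ t ht
          change σ ≤ auxq t ^ 2 at this
          calc σ ^ (N+1) ≤ (auxq t ^ 2) ^ (N+1) := by gcongr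
            _ = _ := by ring
      _ ≤ A := by
          apply setIntegral_mono_set hAint
          · filter_upwards [ae_restrict_mem measurableSet_Ioi] with t ht
            have := auxq_nonneg t (le_of_lt ht)
            simp only [Pi.zero_apply]; positivity
          · exact hsub.eventuallyLE
  have hApos : 0 < A := lt_of_lt_of_le (by have : 0 < b - a := by linarith
                                           positivity) hAlow
  set I : ℕ → ℕ → ℝ := fun j k => ∫ t in Set.Ioi (0:ℝ), auxq (μ j * t) ^ (N+1) * auxq (μ k * t) ^ (N+1) with hI
  have hI0 : ∀ j k, 0 ≤ I j k := by
    intro j k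
    apply setIntegral_nonneg measurableSet_Ioi
    intro t ht
    have ht : 0 < t := ht
    have h1 := auxq_nonneg (μ j*t) (mul_pos (hμ j) ht).le
    have h2 := auxq_nonneg (μ k*t) (mul_pos (hμ k) ht).le
    positivity
  have hIdiag : ∀ j, I j j = A / μ j := by
    intro j
    have := integral_comp_mul_left_Ioi (fun t => auxq t ^ (N+1) * auxq t ^ (N+1)) 0 (hμ j)
    simp only [mul_zero, smul_eq_mul] at this
    rw [hI]; simp only; rw [this, hA]; field_simp
  have hIoff' : ∀ j k, j < k → I j k ≤ 16 * ρ ^ N / (μ j + μ k) := by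
    intro j k hjk
    have hpos := add_pos (hμ j) (hμ k)
    have : 16 * ρ ^ N / (μ j + μ k) = ∫ t in Set.Ioi (0:ℝ), 16 * ρ ^ N * Real.exp (-(μ j + μ k) * t) := by
      rw [integral_const_mul, aux_int_exp _ hpos]; ring
    rw [this]
    apply setIntegral_mono_on (auxq_intble _ _ (hμ j) (hμ k) N) ((aux_intble_exp _ hpos).const_mul _) measurableSet_Ioi
    intro t ht
    have ht : 0 < t := ht
    apply auxq_prod_le _ _ _ _ (hμ j) (hμ k) ht
    have hratio : γ ≤ μ k / μ j := by
      rw [le_div_iff₀ (hμ j)]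
      obtain ⟨e, rfl⟩ := Nat.exists_eq_add_of_lt hjk
      have h3 := aux_geom μ γ hγ hl j (e+1)
      rw [← add_assoc] at h3
      refine le_trans ?_ h3
      have : γ ≤ γ ^ (e+1) := le_self_pow₀ hγ.le (by omega)
      have := hμ j
      gcongr
    have h4 := hρ (μ j * t) (mul_pos (hμ j) ht) _ hratio
    have e : μ k / μ j * (μ j * t) = μ k * t := by have := (hμ j).ne'; field_simp
    rw [e] at h4
    exact h4
  have hIsymm : ∀ j k, I j k = I k j := by
    intro j k
    exact integral_congr_ae (Eventually.of_forall fun t => mul_comm _ _)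
  have hIoff : ∀ j k, j ≠ k → I j k ≤ 16 * ρ ^ N / (μ j + μ k) := by
    intro j k hjk
    rcases lt_or_gt_of_ne hjk with h | h
    · exact hIoff' j k h
    · rw [hIsymm, add_comm]; exact hIoff' k j h
  set R := ∑ m ∈ Finset.range d, r m ^ 2 with hR
  set H := ∑ m ∈ Finset.range d, 1 / ((m:ℝ)+1) with hH
  have hR0 : 0 ≤ R := Finset.sum_nonneg fun m _ => sq_nonneg _
  have hH0 : 0 ≤ H := Finset.sum_nonneg fun m _ => by positivity
  refine ⟨2 * (R * H) / A + 1, by positivity, fun n c => ?_⟩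
  set E := ∑ j ∈ Finset.range n, c j ^ 2 / μ j with hE
  set G := ∑ j ∈ Finset.range n, ∑ k ∈ Finset.range n, c j * c k / (μ j + μ k) with hG
  have hG0 : 0 ≤ G := by
    have := auxF_int μ hμ n c 1 one_pos
    rw [div_one, one_mul] at this
    rw [hG, ← this]
    exact integral_nonneg fun t => sq_nonneg _
  have hsq : ∀ t, (∑ j ∈ Finset.range n, c j * auxq (μ j * t) ^ (N+1)) ^ 2 =
      ∑ j ∈ Finset.range n, ∑ k ∈ Finset.range n, c j * c k * (auxq (μ j * t) ^ (N+1) * auxq (μ k * t) ^ (N+1)) := by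
    intro t
    rw [sq, Finset.sum_mul_sum]
    refine Finset.sum_congr rfl fun j _ => Finset.sum_congr rfl fun k _ => ?_
    ring
  have hii : ∀ j k, IntegrableOn (fun t => c j * c k * (auxq (μ j * t) ^ (N+1) * auxq (μ k * t) ^ (N+1))) (Set.Ioi (0:ℝ)) :=
    fun j k => (auxq_intble _ _ (hμ j) (hμ k) N).const_mul _
  have hT : ∫ t in Set.Ioi (0:ℝ), (∑ j ∈ Finset.range n, c j * auxq (μ j * t) ^ (N+1)) ^ 2 =
      ∑ j ∈ Finset.range n, ∑ k ∈ Finset.range n, c j * c k * I j k := by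
    simp only [hsq]
    rw [integral_finsetSum _ fun j _ => integrable_finsetSum _ fun k _ => hii j k]
    refine Finset.sum_congr rfl fun j _ => ?_
    rw [integral_finsetSum _ fun k _ => hii j k]
    refine Finset.sum_congr rfl fun k _ => ?_
    rw [integral_const_mul]
  have hTint : IntegrableOn (fun t => (∑ j ∈ Finset.range n, c j * auxq (μ j * t) ^ (N+1)) ^ 2) (Set.Ioi (0:ℝ)) := by
    simp only [hsq]
    exact integrable_finsetSum _ fun j _ => integrable_finsetSum _ fun k _ => hii j k
  have hlow : A / 2 * E ≤ ∑ j ∈ Finset.range n, ∑ k ∈ Finset.range n, c j * c k * I j k := by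
    have hterm : ∀ j k, (if j = k then A * (c j ^ 2 / μ j) else 0) - 16 * ρ ^ N * (|c j| * |c k| / (μ j + μ k))
        ≤ c j * c k * I j k := by
      intro j k
      have hpos := add_pos (hμ j) (hμ k)
      split_ifs with h
      · subst h
        rw [hIdiag]
        have : 0 ≤ 16 * ρ ^ N * (|c j| * |c j| / (μ j + μ j)) := by positivity
        have e : c j * c j * (A / μ j) = A * (c j ^ 2 / μ j) := by ring
        rw [e]; linarith
      · have h1 := hIoff j k h
        have h2 : -(|c j| * |c k|) ≤ c j * c k := by rw [← abs_mul]; exact neg_abs_le _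
        have h3 : 0 ≤ |c j| * |c k| := by positivity
        calc _ = -(|c j| * |c k|) * (16 * ρ ^ N / (μ j + μ k)) := by ring
          _ ≤ -(|c j| * |c k|) * I j k := by nlinarith
          _ ≤ _ := by nlinarith [hI0 j k]
    have hsum := Finset.sum_le_sum fun j (_ : j ∈ Finset.range n) =>
      Finset.sum_le_sum fun k (_ : k ∈ Finset.range n) => hterm j k
    have e1 : ∑ j ∈ Finset.range n, ∑ k ∈ Finset.range n, ((if j = k then A * (c j ^ 2 / μ j) else 0) - 16 * ρ ^ N * (|c j| * |c k| / (μ j + μ k)))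
      = A * E - 16 * ρ ^ N * ∑ j ∈ Finset.range n, ∑ k ∈ Finset.range n, |c j| * |c k| / (μ j + μ k) := by
      simp only [Finset.sum_sub_distrib, Finset.mul_sum, hE]
      congr 1
      refine Finset.sum_congr rfl fun j hj => ?_
      rw [Finset.sum_ite_eq, if_pos hj]
    rw [e1] at hsum
    refine le_trans ?_ hsum
    have h5 := hschur n c
    have hE0 : 0 ≤ E := Finset.sum_nonneg fun j _ => div_nonneg (sq_nonneg _) (hμ j).le
    have h6 : 16 * ρ ^ N * ∑ j ∈ Finset.range n, ∑ k ∈ Finset.range n, |c j| * |c k| / (μ j + μ k) ≤ 16 * ρ ^ N * (S * E) := by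
      gcongr
    have h7 : 32 * S * ρ ^ N * E ≤ A * E := by
      gcongr
      linarith
    linarith
  have hup : ∫ t in Set.Ioi (0:ℝ), (∑ j ∈ Finset.range n, c j * auxq (μ j * t) ^ (N+1)) ^ 2 ≤ R * H * G := by
    have hFi : ∀ m : ℕ, IntegrableOn (fun t => (∑ j ∈ Finset.range n, c j * Real.exp (-(μ j * (((m:ℝ)+1) * t)))) ^ 2) (Set.Ioi (0:ℝ)) :=
      fun m => auxF_intble μ hμ n c _ (by positivity)
    have : R * H * G = ∫ t in Set.Ioi (0:ℝ), R * ∑ m ∈ Finset.range d, (∑ j ∈ Finset.range n, c j * Real.exp (-(μ j * (((m:ℝ)+1) * t)))) ^ 2 := by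
      rw [integral_const_mul, integral_finsetSum _ fun m _ => hFi m, mul_assoc]
      have e0 : H * G = ∑ m ∈ Finset.range d, 1 / ((m:ℝ)+1) * G := by rw [hH, Finset.sum_mul]
      rw [e0]
      refine congrArg (fun z => R * z) ?_
      refine Finset.sum_congr rfl fun m _ => ?_
      rw [auxF_int μ hμ n c _ (by positivity)]
    rw [this]
    apply integral_mono hTint
    · exact (integrable_finsetSum _ fun m _ => hFi m).const_mul R
    · intro t
      have e : ∑ j ∈ Finset.range n, c j * auxq (μ j * t) ^ (N+1) =
          ∑ m ∈ Finset.range d, r m * ∑ j ∈ Finset.range n, c j * Real.exp (-(μ j * (((m:ℝ)+1) * t))) := by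
        simp only [hr, Finset.mul_sum]
        rw [Finset.sum_comm]
        refine Finset.sum_congr rfl fun m _ => Finset.sum_congr rfl fun j _ => ?_
        ring_nf
      simp only [e]
      exact Finset.sum_mul_sq_le_sq_mul_sq _ _ _
  have hfin : A / 2 * E ≤ R * H * G := by rw [hT] at hup; exact hlow.trans hup
  have h8 : E ≤ 2 * (R * H) / A * G := by
    rw [div_mul_eq_mul_div, le_div_iff₀ hApos]; linarith
  linarith

def auxGood (φ : ℝ → ℝ) (k : ℕ) (xs : Fin k → ℝ) (M y : ℝ) : Prop :=
  φ y ≤ Real.exp (-M) ∨ ∃ i, φ y ≤ Real.exp (-(M * |y - xs i|))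

lemma auxGood_mono (φ : ℝ → ℝ) (k : ℕ) (xs : Fin k → ℝ) (M M' y : ℝ) (h : M' ≤ M)
    (hg : auxGood φ k xs M y) : auxGood φ k xs M' y := by
  rcases hg with hg | ⟨i, hg⟩
  · left; refine hg.trans ?_; gcongr
  · right; refine ⟨i, hg.trans ?_⟩; gcongr

lemma aux_local
    (φ : ℝ → ℝ)
    (hmaps : Set.MapsTo φ (Set.Icc (0 : ℝ) 1) (Set.Icc (0 : ℝ) 1))
    (hsup : essSupOn φ Set.univ = (1 : EReal))
    (k : ℕ) (xs : Fin k → ℝ) (hM : essMaxPts φ = Set.range xs)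
    (hone : ∀ i, φ (xs i) = 1)
    (hleft : ∀ i : Fin k, 0 < xs i → ∃ M : ℝ, 0 < M ∧
      ∀ᶠ t in nhdsWithin (xs i) (Set.Ico 0 (xs i)),
        M ≤ (φ (xs i) - φ t) / (xs i - t))
    (hright : ∀ i : Fin k, xs i < 1 → ∃ M : ℝ, 0 < M ∧
      ∀ᶠ t in nhdsWithin (xs i) (Set.Ioc (xs i) 1),
        (φ (xs i) - φ t) / (xs i - t) ≤ -M) (x : ℝ) (hx : x ∈ Set.Icc (0:ℝ) 1) :
    ∃ U ∈ nhdsWithin x (Set.Icc (0:ℝ) 1), ∃ M : ℝ, 0 < M ∧ ∀ᵐ y ∂m01, y ∈ U → auxGood φ k xs M y := by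
  have hae : ∀ᵐ y ∂m01, y ∈ Set.Icc (0:ℝ) 1 := ae_restrict_mem measurableSet_Icc
  by_cases hxm : x ∈ essMaxPts φ
  · rw [hM] at hxm
    obtain ⟨i, rfl⟩ := hxm
    have hL : ∃ M : ℝ, 0 < M ∧ ∀ᶠ t in nhds (xs i), t ∈ Set.Ico 0 (xs i) → φ t ≤ Real.exp (-(M * |t - xs i|)) := by
      by_cases h0 : 0 < xs i
      · obtain ⟨M, hM0, hev⟩ := hleft i h0
        refine ⟨M, hM0, ?_⟩
        filter_upwards [eventually_nhdsWithin_iff.1 hev] with t ht hmem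
        have h1 := ht hmem
        have h2 : 0 < xs i - t := sub_pos.2 hmem.2
        rw [le_div_iff₀ h2, hone] at h1
        rw [abs_sub_comm, abs_of_pos h2]
        have := Real.add_one_le_exp (-(M * (xs i - t)))
        linarith
      · refine ⟨1, one_pos, Eventually.of_forall fun t ht => ?_⟩
        exact absurd (ht.1.trans_lt ht.2) h0
    have hR : ∃ M : ℝ, 0 < M ∧ ∀ᶠ t in nhds (xs i), t ∈ Set.Ioc (xs i) 1 → φ t ≤ Real.exp (-(M * |t - xs i|)) := by
      by_cases h0 : xs i < 1
      · obtain ⟨M, hM0, hev⟩ := hright i h0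
        refine ⟨M, hM0, ?_⟩
        filter_upwards [eventually_nhdsWithin_iff.1 hev] with t ht hmem
        have h1 := ht hmem
        have h2 : xs i - t < 0 := sub_neg.2 hmem.1
        rw [div_le_iff_of_neg h2, hone] at h1
        rw [abs_sub_comm, abs_of_neg h2]
        have := Real.add_one_le_exp (-(M * -(xs i - t)))
        linarith
      · refine ⟨1, one_pos, Eventually.of_forall fun t ht => ?_⟩
        exact absurd (ht.1.trans_le ht.2) h0
    obtain ⟨M1, hM1, h1⟩ := hL
    obtain ⟨M2, hM2, h2⟩ := hR
    refine ⟨_, mem_nhdsWithin_of_mem_nhds (h1.and h2), min M1 M2, lt_min hM1 hM2, ?_⟩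
    filter_upwards [hae] with y hy hU
    rcases lt_trichotomy y (xs i) with h | h | h
    · exact auxGood_mono _ _ _ M1 _ _ (min_le_left _ _) (Or.inr ⟨i, hU.1 ⟨hy.1, h⟩⟩)
    · right; refine ⟨i, ?_⟩; rw [h, hone]; simp
    · exact auxGood_mono _ _ _ M2 _ _ (min_le_right _ _) (Or.inr ⟨i, hU.2 ⟨h, hy.2⟩⟩)
  · have : ∃ E ∈ nhdsWithin x (Set.Icc (0:ℝ) 1), essSupOn φ E ≠ 1 := by
      by_contra hcon
      push Not at hcon
      exact hxm ⟨hx, fun E hE => by rw [hcon E hE, hsup]⟩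
    obtain ⟨E, hE, hne⟩ := this
    have hle : essSupOn φ E ≤ 1 := by
      refine essSup_le_of_ae_le _ ?_
      apply ae_restrict_of_ae
      filter_upwards [hae] with y hy
      exact_mod_cast (hmaps hy).2
    have hlt := lt_of_le_of_ne hle hne
    obtain ⟨c, hc1, hc2⟩ := EReal.lt_iff_exists_real_btwn.1 hlt
    have hc2 : c < 1 := by exact_mod_cast hc2
    set c' := max c (1/2) with hc'
    have hc'0 : 0 < c' := lt_max_of_lt_right (by norm_num)
    have hc'1 : c' < 1 := max_lt hc2 (by norm_num)
    refine ⟨E, hE, -Real.log c', ?_, ?_⟩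
    · have := Real.log_neg hc'0 hc'1; linarith
    · have h3 := ae_imp_of_ae_restrict (ae_lt_of_essSup_lt hc1)
      filter_upwards [h3] with y hy hyE
      left
      rw [neg_neg, Real.exp_log hc'0]
      have : φ y < c := by exact_mod_cast hy hyE
      exact this.le.trans (le_max_left _ _)

lemma aux_global
    (φ : ℝ → ℝ)
    (k : ℕ) (xs : Fin k → ℝ)
    (hloc : ∀ x ∈ Set.Icc (0:ℝ) 1, ∃ U ∈ nhdsWithin x (Set.Icc (0:ℝ) 1), ∃ M : ℝ, 0 < M ∧
      ∀ᵐ y ∂m01, y ∈ U → auxGood φ k xs M y) :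
    ∃ M : ℝ, 0 < M ∧ ∀ᵐ y ∂m01, auxGood φ k xs M y := by
  have hae : ∀ᵐ y ∂m01, y ∈ Set.Icc (0:ℝ) 1 := ae_restrict_mem measurableSet_Icc
  have : ∃ M : ℝ, 0 < M ∧ ∀ᵐ y ∂m01, y ∈ Set.Icc (0:ℝ) 1 → auxGood φ k xs M y := by
    refine IsCompact.induction_on (p := fun s => ∃ M : ℝ, 0 < M ∧ ∀ᵐ y ∂m01, y ∈ s → auxGood φ k xs M y)
      isCompact_Icc ?_ ?_ ?_ hloc
    · exact ⟨1, one_pos, by simp⟩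
    · rintro s t hst ⟨M, hM, h⟩
      exact ⟨M, hM, h.mono fun y hy hys => hy (hst hys)⟩
    · rintro s t ⟨M1, hM1, h1⟩ ⟨M2, hM2, h2⟩
      refine ⟨min M1 M2, lt_min hM1 hM2, ?_⟩
      filter_upwards [h1, h2] with y a b hy
      rcases hy with hy | hy
      · exact auxGood_mono _ _ _ M1 _ _ (min_le_left _ _) (a hy)
      · exact auxGood_mono _ _ _ M2 _ _ (min_le_right _ _) (b hy)
  obtain ⟨M, hM, h⟩ := this
  exact ⟨M, hM, by filter_upwards [h, hae] with y a b using a b⟩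

lemma aux_abs_int (a x : ℝ) (ha : 0 < a) :
    Integrable (fun y : ℝ => Real.exp (-(a * |y - x|))) ∧ ∫ y : ℝ, Real.exp (-(a * |y - x|)) = 2 / a := by
  have h2 : ∫ y : ℝ, Real.exp (-(a * |y|)) = 2 / a := by
    rw [integral_comp_abs (f := fun y => Real.exp (-(a * y)))]
    have := aux_int_exp a ha
    simp only [neg_mul] at this
    rw [this]; ring
  have h1 : Integrable (fun y : ℝ => Real.exp (-(a * |y|))) := by
    by_contra hc
    rw [integral_undef hc] at h2
    have : 0 < 2 / a := by positivity
    linarith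
  refine ⟨h1.comp_sub_right x, ?_⟩
  rw [integral_sub_right_eq_self (fun y : ℝ => Real.exp (-(a * |y|))) x, h2]

lemma aux_moment_intble (φ : ℝ → ℝ) (hmeas : Measurable φ)
    (hmaps : Set.MapsTo φ (Set.Icc (0 : ℝ) 1) (Set.Icc (0 : ℝ) 1)) (a : ℝ) (ha : 0 < a) :
    Integrable (fun y => φ y ^ a) m01 := by
  have hae : ∀ᵐ y ∂m01, y ∈ Set.Icc (0:ℝ) 1 := ae_restrict_mem measurableSet_Icc
  have : IsFiniteMeasure m01 := by unfold m01; infer_instance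
  refine Integrable.mono' (integrable_const (1:ℝ)) (hmeas.pow_const a).aestronglyMeasurable ?_
  filter_upwards [hae] with y hy
  have h := hmaps hy
  rw [Real.norm_of_nonneg (Real.rpow_nonneg h.1 _)]
  exact Real.rpow_le_one h.1 h.2 ha.le

lemma aux_moment (φ : ℝ → ℝ) (hmeas : Measurable φ)
    (hmaps : Set.MapsTo φ (Set.Icc (0 : ℝ) 1) (Set.Icc (0 : ℝ) 1))
    (k : ℕ) (xs : Fin k → ℝ) (hxs : ∀ i, xs i ∈ Set.Icc (0:ℝ) 1) (M : ℝ) (hM0 : 0 < M) (hg : ∀ᵐ y ∂m01, auxGood φ k xs M y) :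
    ∃ K : ℝ, 0 < K ∧ ∀ a : ℝ, 0 < a → ∫ y, φ y ^ a ∂m01 ≤ K / (a + 1) := by
  have hae : ∀ᵐ y ∂m01, y ∈ Set.Icc (0:ℝ) 1 := ae_restrict_mem measurableSet_Icc
  have hfin : IsFiniteMeasure m01 := by unfold m01; infer_instance
  have hle : m01 ≤ volume := Measure.restrict_le_self
  refine ⟨Real.exp M * (1 / M + k * (2 / M)), by positivity, fun a ha => ?_⟩
  have hb : 0 < (a+1) * M := by positivity
  have hint : ∀ i, Integrable (fun y => Real.exp (-((a+1) * M * |y - xs i|))) m01 :=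
    fun i => (aux_abs_int _ (xs i) hb).1.mono_measure hle
  have hpt : ∀ᵐ y ∂m01, φ y ^ a ≤ Real.exp M * (Real.exp (-((a+1) * M)) + ∑ i, Real.exp (-((a+1) * M * |y - xs i|))) := by
    filter_upwards [hg, hae] with y hy hy01
    have h0 := (hmaps hy01).1
    have hkey : ∀ d : ℝ, d ≤ 1 → φ y ≤ Real.exp (-(M * d)) →
        φ y ^ a ≤ Real.exp M * Real.exp (-((a+1) * M * d)) := by
      intro d hd h
      calc φ y ^ a ≤ Real.exp (-(M * d)) ^ a := Real.rpow_le_rpow h0 h ha.le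
        _ = Real.exp (-(M * d) * a) := by rw [← Real.exp_mul]
        _ ≤ Real.exp (M + -((a+1) * M * d)) := by
            rw [Real.exp_le_exp]; nlinarith
        _ = _ := Real.exp_add _ _
    have hs0 : 0 ≤ ∑ i, Real.exp (-((a+1) * M * |y - xs i|)) :=
      Finset.sum_nonneg fun i _ => (Real.exp_pos _).le
    rcases hy with h | ⟨i, h⟩
    · have := hkey 1 le_rfl (by simpa using h)
      rw [mul_one] at this
      refine this.trans ?_
      gcongr
      linarith
    · have hd : |y - xs i| ≤ 1 := by
        rw [abs_le]
        constructor <;> linarith [(hxs i).1, (hxs i).2, hy01.1, hy01.2]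
      refine (hkey _ hd h).trans ?_
      gcongr
      have := Finset.single_le_sum (f := fun i => Real.exp (-((a+1) * M * |y - xs i|)))
        (fun i _ => (Real.exp_pos _).le) (Finset.mem_univ i)
      have h3 := Real.exp_pos (-((a+1) * M))
      linarith
  calc ∫ y, φ y ^ a ∂m01 ≤ ∫ y, Real.exp M * (Real.exp (-((a+1) * M)) + ∑ i, Real.exp (-((a+1) * M * |y - xs i|))) ∂m01 := by
        apply integral_mono_ae (aux_moment_intble φ hmeas hmaps a ha) _ hpt
        exact ((integrable_const _).add (integrable_finsetSum _ fun i _ => hint i)).const_mul _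
    _ = Real.exp M * (Real.exp (-((a+1) * M)) + ∑ i, ∫ y, Real.exp (-((a+1) * M * |y - xs i|)) ∂m01) := by
        rw [integral_const_mul, integral_add (integrable_const _) (integrable_finsetSum _ fun i _ => hint i),
          integral_finsetSum _ fun i _ => hint i]
        simp [m01]
    _ ≤ Real.exp M * (1 / ((a+1) * M) + ∑ i : Fin k, 2 / ((a+1) * M)) := by
        gcongr with i
        · rw [Real.exp_neg, ← one_div]
          gcongr
          linarith [Real.add_one_le_exp ((a+1) * M)]
        · rw [← (aux_abs_int _ (xs i) hb).2]
          exact integral_mono_measure hle (Eventually.of_forall fun y => (Real.exp_pos _).le) (aux_abs_int _ (xs i) hb).1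
    _ = _ := by
        simp; field_simp

lemma aux_span (Λ : ℕ → ℝ) (g : ℝ → ℝ) (hg : inSpan Λ g) :
    ∃ (n : ℕ) (c : ℕ → ℝ), ∀ x, g x = ∑ j ∈ Finset.range n, c j * x ^ (Λ j) := by
  obtain ⟨n, c, k, h⟩ := hg
  refine ⟨(Finset.univ.sup k) + 1, fun j => ∑ i with k i = j, c i, fun x => ?_⟩
  rw [h x, ← Finset.sum_fiberwise_of_maps_to (s := Finset.univ) (t := Finset.range (Finset.univ.sup k + 1)) (g := k)]
  · refine Finset.sum_congr rfl fun j _ => ?_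
    rw [Finset.sum_mul]
    refine Finset.sum_congr rfl fun i hi => ?_
    rw [(Finset.mem_filter.1 hi).2]
  · intro i _
    rw [Finset.mem_range, Nat.lt_succ_iff]
    exact Finset.le_sup (f := k) (Finset.mem_univ i)

lemma aux_quad (Λ : ℕ → ℝ) (hpos : ∀ k, 0 < Λ k) (φ : ℝ → ℝ) (hmeas : Measurable φ)
    (hmaps : Set.MapsTo φ (Set.Icc (0 : ℝ) 1) (Set.Icc (0 : ℝ) 1)) (n : ℕ) (c : ℕ → ℝ) :
    ∫ x, |∑ j ∈ Finset.range n, c j * φ x ^ (Λ j)| ^ 2 ∂m01 =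
      ∑ j ∈ Finset.range n, ∑ k ∈ Finset.range n, c j * c k * ∫ x, φ x ^ (Λ j + Λ k) ∂m01 := by
  have hae : ∀ᵐ y ∂m01, y ∈ Set.Icc (0:ℝ) 1 := ae_restrict_mem measurableSet_Icc
  have h1 : ∫ x, |∑ j ∈ Finset.range n, c j * φ x ^ (Λ j)| ^ 2 ∂m01 =
      ∫ x, ∑ j ∈ Finset.range n, ∑ k ∈ Finset.range n, c j * c k * φ x ^ (Λ j + Λ k) ∂m01 := by
    apply integral_congr_ae
    filter_upwards [hae] with x hx
    rw [sq_abs, sq, Finset.sum_mul_sum]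
    refine Finset.sum_congr rfl fun j _ => Finset.sum_congr rfl fun k _ => ?_
    rw [Real.rpow_add_of_nonneg (hmaps hx).1 (hpos j).le (hpos k).le]; ring
  have hi : ∀ j k, Integrable (fun x => c j * c k * φ x ^ (Λ j + Λ k)) m01 := fun j k =>
    (aux_moment_intble φ hmeas hmaps _ (add_pos (hpos j) (hpos k))).const_mul _
  rw [h1, integral_finsetSum _ fun j _ => integrable_finsetSum _ fun k _ => hi j k]
  refine Finset.sum_congr rfl fun j _ => ?_
  rw [integral_finsetSum _ fun k _ => hi j k]
  refine Finset.sum_congr rfl fun k _ => ?_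
  rw [integral_const_mul]

lemma aux_id_moment (a : ℝ) (ha : 0 < a) : ∫ x, x ^ a ∂m01 = 1 / (a + 1) := by
  rw [m01, integral_Icc_eq_integral_Ioc, ← intervalIntegral.integral_of_le zero_le_one,
    integral_rpow (Or.inl (by linarith))]
  rw [Real.one_rpow, Real.zero_rpow (by linarith), sub_zero]

/-- Let `Λ` be lacunary with `∑ 1/λ_k < ∞` and let
`φ : [0,1] → [0,1]` be Borel measurable with `ess sup φ = 1` and finitely many essential
points of maximum `x_1, …, x_k`, with `φ(x_i) = 1`. If at each `x_i` the lower left Dini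
derivative is positive (when `x_i > 0`) and the upper right Dini derivative is negative
(when `x_i < 1`), then `C_φ : M²_Λ → L²([0,1])` is bounded. -/
theorem composition_operator_bounded
    (Λ : ℕ → ℝ) (hpos : ∀ k, 0 < Λ k)
    (hlac : ∃ γ : ℝ, 1 < γ ∧ ∀ k, γ * Λ k ≤ Λ (k + 1))
    (hsum : Summable fun k => 1 / Λ k)
    (φ : ℝ → ℝ) (hmeas : Measurable φ)
    (hmaps : Set.MapsTo φ (Set.Icc (0 : ℝ) 1) (Set.Icc (0 : ℝ) 1))
    (hsup : essSupOn φ Set.univ = (1 : EReal))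
    (k : ℕ) (xs : Fin k → ℝ) (hM : essMaxPts φ = Set.range xs)
    (hone : ∀ i, φ (xs i) = 1)
    (hleft : ∀ i : Fin k, 0 < xs i → ∃ M : ℝ, 0 < M ∧
      ∀ᶠ t in nhdsWithin (xs i) (Set.Ico 0 (xs i)),
        M ≤ (φ (xs i) - φ t) / (xs i - t))
    (hright : ∀ i : Fin k, xs i < 1 → ∃ M : ℝ, 0 < M ∧
      ∀ᶠ t in nhdsWithin (xs i) (Set.Ioc (xs i) 1),
        (φ (xs i) - φ t) / (xs i - t) ≤ -M) :
    ∃ C : ℝ, 0 < C ∧ ∀ g : ℝ → ℝ, inSpan Λ g →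
      (∫ x in Set.Icc (0 : ℝ) 1, |g (φ x)| ^ 2) ≤
        C ^ 2 * ∫ x in Set.Icc (0 : ℝ) 1, |g x| ^ 2 := by
  have hloc := aux_local φ hmaps hsup k xs hM hone hleft hright
  obtain ⟨M, hM0, hg⟩ := aux_global φ k xs hloc
  have hxs : ∀ i, xs i ∈ Set.Icc (0:ℝ) 1 := by
    intro i
    have : xs i ∈ essMaxPts φ := by rw [hM]; exact ⟨i, rfl⟩
    exact this.1
  obtain ⟨K, hK, hmom⟩ := aux_moment φ hmeas hmaps k xs hxs M hM0 hg
  obtain ⟨γ, hγ, hl⟩ := hlac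
  have hmono : ∀ j, Λ 0 ≤ Λ j := by
    intro j
    induction j with
    | zero => exact le_rfl
    | succ j ih => nlinarith [hl j, hpos j]
  set μ : ℕ → ℝ := fun j => Λ j + 1/2 with hμdef
  have hμ : ∀ j, 0 < μ j := fun j => by have := hpos j; simp only [hμdef]; linarith
  have h00 := hpos 0
  have hγ' : 1 < 1 + (γ - 1) * Λ 0 / (Λ 0 + 1/2) := by
    have : 0 < γ - 1 := by linarith
    have : 0 < (γ - 1) * Λ 0 / (Λ 0 + 1/2) := by positivity
    linarith
  have hlμ : ∀ j, (1 + (γ - 1) * Λ 0 / (Λ 0 + 1/2)) * μ j ≤ μ (j+1) := by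
    intro j
    have h1 := hl j
    have h2 := hmono j
    have h3 : (γ - 1) * Λ 0 / (Λ 0 + 1/2) * (Λ j + 1/2) ≤ (γ - 1) * Λ j := by
      rw [div_mul_eq_mul_div, div_le_iff₀ (by linarith)]
      nlinarith
    simp only [hμdef]
    linarith
  obtain ⟨S, hS, hschur⟩ := aux_schur μ hμ _ hγ' hlμ
  obtain ⟨B, hB, hlow⟩ := aux_lower μ hμ _ hγ' hlμ
  refine ⟨√(K * S * B), by positivity, fun g hgs => ?_⟩
  rw [Real.sq_sqrt (by positivity)]
  obtain ⟨n, c, hgc⟩ := aux_span Λ g hgs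
  have hadd : ∀ i j, Λ i + Λ j + 1 = μ i + μ j := fun i j => by simp only [hμdef]; ring
  have e1 : ∫ x in Set.Icc (0 : ℝ) 1, |g x| ^ 2 =
      ∑ i ∈ Finset.range n, ∑ j ∈ Finset.range n, c i * c j / (μ i + μ j) := by
    have := aux_quad Λ hpos (fun x => x) measurable_id (fun x hx => hx) n c
    simp only [hgc]
    refine this.trans ?_
    refine Finset.sum_congr rfl fun i _ => Finset.sum_congr rfl fun j _ => ?_
    rw [aux_id_moment _ (add_pos (hpos i) (hpos j)), hadd]; ring
  have e2 : ∫ x in Set.Icc (0 : ℝ) 1, |g (φ x)| ^ 2 =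
      ∑ i ∈ Finset.range n, ∑ j ∈ Finset.range n, c i * c j * ∫ x, φ x ^ (Λ i + Λ j) ∂m01 := by
    simp only [hgc]
    exact aux_quad Λ hpos φ hmeas hmaps n c
  have h0 : ∀ a : ℝ, 0 ≤ ∫ x, φ x ^ a ∂m01 := by
    intro a
    apply integral_nonneg_of_ae
    have hae : ∀ᵐ y ∂m01, y ∈ Set.Icc (0:ℝ) 1 := ae_restrict_mem measurableSet_Icc
    filter_upwards [hae] with y hy
    exact Real.rpow_nonneg (hmaps hy).1 _
  rw [e1, e2]
  calc _ ≤ ∑ i ∈ Finset.range n, ∑ j ∈ Finset.range n, K * (|c i| * |c j| / (μ i + μ j)) := by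
        refine Finset.sum_le_sum fun i _ => Finset.sum_le_sum fun j _ => ?_
        have h1 := hmom _ (add_pos (hpos i) (hpos j))
        rw [hadd] at h1
        calc _ ≤ (|c i| * |c j|) * ∫ x, φ x ^ (Λ i + Λ j) ∂m01 := by
              apply mul_le_mul_of_nonneg_right _ (h0 _)
              rw [← abs_mul]; exact le_abs_self _
          _ ≤ (|c i| * |c j|) * (K / (μ i + μ j)) := by gcongr
          _ = _ := by ring
    _ = K * ∑ i ∈ Finset.range n, ∑ j ∈ Finset.range n, |c i| * |c j| / (μ i + μ j) := by
        simp only [Finset.mul_sum]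
    _ ≤ K * (S * ∑ j ∈ Finset.range n, c j ^ 2 / μ j) := by
        gcongr; exact hschur n c
    _ ≤ K * (S * (B * ∑ i ∈ Finset.range n, ∑ j ∈ Finset.range n, c i * c j / (μ i + μ j))) := by
        gcongr; exact hlow n c
    _ = _ := by ring
end

section
/- Let Λ = (λ_k)_{k≥1} be a strictly increasing sequence of positive reals with ∑_k 1/λ_k < ∞, and let μ be a finite positive Borel measure on [0,1]. If there exists C > 0 such that ‖g‖_{L²(μ)} ≤ C‖g‖_{L²(m)} for every g in the linear span of the monomials x ↦ x^{λ_k} (m denotes Lebesgue measure on [0,1]), then liminf_{δ→0⁺} μ([1−δ,1])/δ < ∞. -/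
open MeasureTheory Filter

lemma aux_norm (l : ℝ) (hl : 1 ≤ l) :
    eLpNorm (fun x : ℝ => x ^ l) 2 m01 ^ (2:ℝ) ≤ ENNReal.ofReal (1 / (2 * l)) := by
  have h := eLpNorm_nnreal_pow_eq_lintegral (f := fun x : ℝ => x ^ l) (μ := m01) (p := 2)
    (by norm_num)
  simp only [ENNReal.coe_ofNat, NNReal.coe_ofNat] at h
  rw [h, m01]
  have e : ∫⁻ x in Set.Icc (0:ℝ) 1, ‖x ^ l‖ₑ ^ (2:ℝ)
      = ∫⁻ x in Set.Icc (0:ℝ) 1, ENNReal.ofReal (x ^ (2 * l)) := by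
    apply setLIntegral_congr_fun measurableSet_Icc
    intro x hx
    have h0 : 0 ≤ x ^ l := Real.rpow_nonneg hx.1 _
    simp only
    rw [Real.enorm_eq_ofReal h0, ENNReal.ofReal_rpow_of_nonneg h0 (by norm_num),
      ← Real.rpow_mul hx.1, mul_comm]
  rw [e, ← ofReal_integral_eq_lintegral_ofReal]
  · apply ENNReal.ofReal_le_ofReal
    rw [integral_Icc_eq_integral_Ioc, ← intervalIntegral.integral_of_le zero_le_one,
      integral_rpow (by left; linarith), Real.one_rpow, Real.zero_rpow (by linarith), sub_zero]
    apply one_div_le_one_div_of_le <;> linarith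
  · apply ContinuousOn.integrableOn_Icc
    exact (Real.continuous_rpow_const (by linarith)).continuousOn
  · filter_upwards [ae_restrict_mem measurableSet_Icc] with x hx
    exact Real.rpow_nonneg hx.1 _

/-- Let `Λ` be strictly increasing positive with `∑ 1/λ_k < ∞`, and
let `μ` be a finite positive Borel measure on `[0,1]`. If the embedding
`M²_Λ ⊂ L²(μ)` is bounded, i.e. `‖g‖_{L²(μ)} ≤ C‖g‖_{L²(m)}` on the span of the
monomials, then `liminf_{δ→0⁺} μ([1−δ,1])/δ < ∞`, i.e. the ratios are frequently
bounded as `δ → 0⁺`. -/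
theorem embedding_bounded_liminf_finite
    (Λ : ℕ → ℝ) (hmono : StrictMono Λ) (hpos : ∀ k, 0 < Λ k)
    (hsum : Summable fun k => 1 / Λ k)
    (μ : Measure ℝ) [IsFiniteMeasure μ] (hμsupp : μ (Set.Icc (0 : ℝ) 1)ᶜ = 0)
    (C : ℝ) (hC : 0 < C)
    (hbd : ∀ g : ℝ → ℝ, inSpan Λ g →
      eLpNorm g 2 μ ≤ ENNReal.ofReal C * eLpNorm g 2 m01) :
    ∃ M : ℝ, ∃ᶠ δ in nhdsWithin (0 : ℝ) (Set.Ioi 0),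
      (μ (Set.Icc (1 - δ) 1)).toReal / δ ≤ M := by
  have ht : Tendsto (fun k => 1 / Λ k) atTop (nhds 0) := hsum.tendsto_atTop_zero
  have htd : Tendsto (fun k => 1 / (2 * Λ k)) atTop (nhdsWithin (0 : ℝ) (Set.Ioi 0)) := by
    rw [tendsto_nhdsWithin_iff]
    constructor
    · have := ht.const_mul (1/2)
      simp only [mul_zero] at this
      refine this.congr fun k => ?_
      rw [one_div_mul_one_div]
    · exact Eventually.of_forall fun k => by have := hpos k; simp only [Set.mem_Ioi]; positivity
  refine ⟨4 * C ^ 2, htd.frequently (Eventually.frequently ?_)⟩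
  filter_upwards [ht.eventually (gt_mem_nhds zero_lt_one)] with k hk
  have hl0 := hpos k
  have hl : 1 ≤ Λ k := by
    rw [div_lt_one hl0] at hk; exact hk.le
  generalize hL : Λ k = l at *
  set δ := 1 / (2 * l) with hδ
  have hδ0 : 0 < δ := by positivity
  have hδ1 : δ ≤ 1 / 2 := one_div_le_one_div_of_le (by norm_num) (by linarith)
  have hb := hbd (fun x => x ^ l) ⟨1, fun _ => 1, fun _ => k, fun x => by simp [hL]⟩
  have hmk := mul_meas_ge_le_pow_eLpNorm' μ (p := 2) (by norm_num) (by norm_num)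
    (f := fun x : ℝ => x ^ l)
    (Real.continuous_rpow_const (by linarith)).aestronglyMeasurable (ENNReal.ofReal (1/2))
  simp only [ENNReal.toReal_ofNat] at hmk
  have hsub : Set.Icc (1 - δ) 1 ⊆ {x : ℝ | ENNReal.ofReal (1/2) ≤ ‖x ^ l‖ₑ} := by
    intro x hx
    have hx0 : 0 ≤ x := by linarith [hx.1]
    simp only [Set.mem_setOf_eq]
    rw [Real.enorm_eq_ofReal (Real.rpow_nonneg hx0 _)]
    apply ENNReal.ofReal_le_ofReal
    have h1 := one_add_mul_self_le_rpow_one_add (s := -δ) (by linarith) hl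
    have h2 : (1 + -δ) ^ l ≤ x ^ l :=
      Real.rpow_le_rpow (by linarith) (by linarith [hx.1]) (by linarith)
    have h3 : l * δ = 1 / 2 := by rw [hδ]; field_simp
    linarith
  have key : ENNReal.ofReal (1/4) * μ (Set.Icc (1 - δ) 1) ≤ ENNReal.ofReal (C ^ 2 * δ) := by
    calc ENNReal.ofReal (1/4) * μ (Set.Icc (1 - δ) 1)
        ≤ ENNReal.ofReal (1/2) ^ (2:ℝ) * μ {x : ℝ | ENNReal.ofReal (1/2) ≤ ‖x ^ l‖ₑ} := by
          rw [ENNReal.ofReal_rpow_of_nonneg (by norm_num) (by norm_num)]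
          apply mul_le_mul' _ (measure_mono hsub)
          norm_num
      _ ≤ _ := hmk
      _ ≤ (ENNReal.ofReal C * eLpNorm (fun x : ℝ => x ^ l) 2 m01) ^ (2:ℝ) :=
          ENNReal.rpow_le_rpow hb (by norm_num)
      _ ≤ ENNReal.ofReal (C ^ 2) * ENNReal.ofReal δ := by
          rw [ENNReal.mul_rpow_of_nonneg _ _ (by norm_num),
            ENNReal.ofReal_rpow_of_nonneg hC.le (by norm_num), Real.rpow_two]
          exact mul_le_mul' le_rfl (aux_norm l hl)
      _ = _ := (ENNReal.ofReal_mul (by positivity)).symm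
  have k2 := ENNReal.toReal_mono ENNReal.ofReal_ne_top key
  rw [ENNReal.toReal_mul, ENNReal.toReal_ofReal (by norm_num),
    ENNReal.toReal_ofReal (by positivity)] at k2
  rw [div_le_iff₀ hδ0]
  linarith
end

section
/- Let Λ = (λ_k)_{k≥1} be a strictly increasing sequence of positive reals with ∑_k 1/λ_k < ∞, and let μ be a finite positive Borel measure on [0,1]. Assume the embedding M²_Λ ⊂ L²(μ) is compact in the following sense: there exists C > 0 with ‖g‖_{L²(μ)} ≤ C‖g‖_{L²(m)} for every g in the linear span of the monomials x ↦ x^{λ_k}, and every sequence (g_n) in this span with ‖g_n‖_{L²(m)} ≤ 1 admits a subsequence that is Cauchy in L²(μ). Then liminf_{δ→0⁺} μ([1−δ,1])/δ = 0; in fact λ_n · μ([1−1/λ_n, 1]) → 0 as n → ∞. -/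
open MeasureTheory Filter

lemma aux_low {μ : Measure ℝ} {f : ℝ → ℝ} {S : Set ℝ} (hS : MeasurableSet S)
    (a : ENNReal) (h : ∀ x ∈ S, a ≤ ‖f x‖ₑ) : a ^ 2 * μ S ≤ eLpNorm f 2 μ ^ 2 := by
  have e := eLpNorm_nnreal_pow_eq_lintegral (f := f) (μ := μ) (p := 2) (by norm_num)
  have e2 : eLpNorm f 2 μ ^ 2 = ∫⁻ x, ‖f x‖ₑ ^ 2 ∂μ := by
    simpa using e
  rw [e2, ← setLIntegral_const]
  refine (setLIntegral_mono' hS fun x hx => ?_).trans (setLIntegral_le_lintegral S _)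
  gcongr
  exact h x hx

lemma aux_up (l : ℝ) (hl : 0 < l) :
    eLpNorm (fun x : ℝ => √l * x ^ l) 2 m01 ≤ 1 := by
  have e := eLpNorm_nnreal_pow_eq_lintegral (f := fun x : ℝ => √l * x ^ l) (μ := m01) (p := 2)
    (by norm_num)
  have e2 : eLpNorm (fun x : ℝ => √l * x ^ l) 2 m01 ^ 2
      = ∫⁻ x, ‖√l * x ^ l‖ₑ ^ 2 ∂m01 := by
    simpa using e
  have e3 : ∫⁻ x, ‖√l * x ^ l‖ₑ ^ 2 ∂m01 = ∫⁻ x in Set.Icc (0:ℝ) 1, ENNReal.ofReal (l * x ^ (2 * l)) := by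
    refine setLIntegral_congr_fun measurableSet_Icc fun x hx => ?_
    have h0 : 0 ≤ √l * x ^ l := mul_nonneg (Real.sqrt_nonneg _) (Real.rpow_nonneg hx.1 _)
    rw [Real.enorm_of_nonneg h0, ← ENNReal.ofReal_pow h0, mul_pow, Real.sq_sqrt hl.le,
      ← Real.rpow_mul_natCast hx.1]
    norm_num
    rw [mul_comm l 2]
  have hint : IntegrableOn (fun x : ℝ => l * x ^ (2 * l)) (Set.Icc 0 1) := by
    refine ContinuousOn.integrableOn_Icc ?_
    exact continuousOn_const.mul
      (Real.continuous_rpow_const (by positivity)).continuousOn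
  have e4 : ∫⁻ x in Set.Icc (0:ℝ) 1, ENNReal.ofReal (l * x ^ (2 * l)) ≤ 1 := by
    rw [← ofReal_integral_eq_lintegral_ofReal hint]
    · rw [integral_Icc_eq_integral_Ioc, ← intervalIntegral.integral_of_le zero_le_one,
        intervalIntegral.integral_const_mul, integral_rpow (Or.inl (by linarith))]
      rw [ENNReal.ofReal_le_one, Real.one_rpow, Real.zero_rpow (by positivity), sub_zero,
        mul_one_div, div_le_one (by positivity)]
      linarith
    · filter_upwards [ae_restrict_mem measurableSet_Icc] with x hx
      exact mul_nonneg hl.le (Real.rpow_nonneg hx.1 _)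
  rw [e3] at e2
  rw [← e2] at e4
  by_contra hcon
  push Not at hcon
  exact absurd e4 (not_le.2 (one_lt_pow₀ hcon (by norm_num)))

lemma aux_quarter (l : ℝ) (hl : 2 ≤ l) (x : ℝ) (hx : 1 - 1 / l ≤ x) : 1 / 4 ≤ x ^ l := by
  have hl0 : 0 < l := by linarith
  have h1 : 1 / l ≤ 1 := by rw [div_le_one hl0]; linarith
  have h0 : 0 ≤ 1 - 1 / l := by linarith
  have hb := one_add_mul_self_le_rpow_one_add (s := -(1 / l)) (by linarith) (p := l / 2)
    (by linarith)
  have h2 : 1 + l / 2 * -(1 / l) = 1 / 2 := by field_simp; norm_num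
  rw [h2, ← sub_eq_add_neg] at hb
  have h3 : (1 - 1 / l) ^ l = ((1 - 1 / l) ^ (l / 2)) ^ 2 := by
    rw [← Real.rpow_mul_natCast h0]; congr 1; push_cast; ring
  have h4 : (1 - 1 / l) ^ l ≤ x ^ l := Real.rpow_le_rpow h0 hx hl0.le
  nlinarith

/-- Let `Λ` be strictly increasing positive with `∑ 1/λ_k < ∞`, and
let `μ` be a finite positive Borel measure on `[0,1]`. If the embedding `M²_Λ ⊂ L²(μ)`
is compact (bounded on the span, and every norm-bounded sequence in the span has a
subsequence Cauchy in `L²(μ)`), then `liminf_{δ→0⁺} μ([1−δ,1])/δ = 0`; in fact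
`λ_n · μ([1−1/λ_n, 1]) → 0` as `n → ∞`. -/
theorem embedding_compact_liminf_zero
    (Λ : ℕ → ℝ) (hmono : StrictMono Λ) (hpos : ∀ k, 0 < Λ k)
    (hsum : Summable fun k => 1 / Λ k)
    (μ : Measure ℝ) [IsFiniteMeasure μ] (hμsupp : μ (Set.Icc (0 : ℝ) 1)ᶜ = 0)
    (C : ℝ) (hC : 0 < C)
    (hbd : ∀ g : ℝ → ℝ, inSpan Λ g →
      eLpNorm g 2 μ ≤ ENNReal.ofReal C * eLpNorm g 2 m01)
    (hcpt : ∀ g : ℕ → ℝ → ℝ, (∀ n, inSpan Λ (g n)) →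
      (∀ n, eLpNorm (g n) 2 m01 ≤ 1) →
      ∃ σ : ℕ → ℕ, StrictMono σ ∧
        ∀ ε : ℝ, 0 < ε → ∃ N : ℕ, ∀ j ≥ N, ∀ j' ≥ N,
          eLpNorm (fun x => g (σ j) x - g (σ j') x) 2 μ ≤ ENNReal.ofReal ε) :
    (∀ ε : ℝ, 0 < ε → ∃ᶠ δ in nhdsWithin (0 : ℝ) (Set.Ioi 0),
      (μ (Set.Icc (1 - δ) 1)).toReal / δ < ε) ∧
    Tendsto (fun n => Λ n * (μ (Set.Icc (1 - 1 / Λ n) 1)).toReal)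
      atTop (nhds 0) := by
  have hΛ : Tendsto Λ atTop atTop := by
    have h := hsum.tendsto_atTop_zero
    have h' : Tendsto (fun k => 1 / Λ k) atTop (nhdsWithin 0 (Set.Ioi 0)) :=
      tendsto_nhdsWithin_iff.2 ⟨h, Eventually.of_forall fun k => one_div_pos.2 (hpos k)⟩
    have := h'.inv_tendsto_nhdsGT_zero
    refine this.congr fun k => ?_
    simp
  set h : ℕ → ℝ → ℝ := fun n x => √(Λ n) * x ^ (Λ n) with hh
  have hspan : ∀ n, inSpan Λ (h n) := fun n =>
    ⟨1, fun _ => √(Λ n), fun _ => n, fun x => by simp [hh]⟩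
  have hle : ∀ n, eLpNorm (h n) 2 m01 ≤ 1 := fun n => aux_up _ (hpos n)
  have hmeas : ∀ n, Measurable (h n) := fun n => by
    simp only [hh]; fun_prop
  -- no atom at 1
  have hone : μ {1} = 0 := by
    have hb : ∀ n, Λ n * (μ {1}).toReal ≤ C ^ 2 := by
      intro n
      have h1 := aux_low (μ := μ) (f := h n) (measurableSet_singleton (1:ℝ))
        (ENNReal.ofReal √(Λ n)) (by
          intro x hx
          rw [Set.mem_singleton_iff.1 hx]
          simp only [hh, Real.one_rpow, mul_one]
          rw [Real.enorm_of_nonneg (Real.sqrt_nonneg _)])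
      have h2 : eLpNorm (h n) 2 μ ≤ ENNReal.ofReal C :=
        (hbd _ (hspan n)).trans (mul_le_of_le_one_right' (hle n))
      have h3 := h1.trans (pow_le_pow_left' h2 2)
      rw [← ENNReal.ofReal_pow (Real.sqrt_nonneg _), Real.sq_sqrt (hpos n).le,
        ← ENNReal.ofReal_pow hC.le] at h3
      have h4 := ENNReal.toReal_mono ENNReal.ofReal_ne_top h3
      rwa [ENNReal.toReal_mul, ENNReal.toReal_ofReal (hpos n).le,
        ENNReal.toReal_ofReal (by positivity)] at h4
    by_contra hne
    have hp : 0 < (μ {1}).toReal := ENNReal.toReal_pos hne (measure_ne_top _ _)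
    obtain ⟨n, hn⟩ := ((hΛ.atTop_mul_const hp).eventually_gt_atTop (C ^ 2)).exists
    exact absurd (hb n) (not_le.2 hn)
  have hae : ∀ᵐ x ∂μ, 0 ≤ x ∧ x < 1 := by
    have a1 : ∀ᵐ x ∂μ, x ∈ Set.Icc (0:ℝ) 1 := by
      rw [ae_iff]; exact hμsupp
    have a2 : ∀ᵐ x ∂μ, x ≠ 1 := by
      rw [ae_iff]; simpa using hone
    filter_upwards [a1, a2] with x h1 h2
    exact ⟨h1.1, lt_of_le_of_ne h1.2 h2⟩
  have hpt : ∀ x : ℝ, 0 ≤ x → x < 1 → Tendsto (fun n => h n x) atTop (nhds 0) := by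
    intro x hx0 hx1
    rcases hx0.eq_or_lt with rfl | hx0
    · refine tendsto_const_nhds.congr fun n => ?_
      simp [hh, Real.zero_rpow (hpos n).ne']
    · have hb : 0 < -Real.log x := by
        have := Real.log_neg hx0 hx1
        linarith
      have := (tendsto_rpow_mul_exp_neg_mul_atTop_nhds_zero (1/2) _ hb).comp hΛ
      refine this.congr fun n => ?_
      simp only [Function.comp, hh]
      rw [Real.sqrt_eq_rpow, Real.rpow_def_of_pos hx0]
      simp
  have key : Tendsto (fun n => eLpNorm (h n) 2 μ) atTop (nhds 0) := by
    refine tendsto_of_subseq_tendsto fun ns hns => ?_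
    obtain ⟨σ, hσ, hc⟩ := hcpt (fun n => h (ns n)) (fun n => hspan _) (fun n => hle _)
    refine ⟨σ, ?_⟩
    have hto : Tendsto (fun j => ns (σ j)) atTop atTop := hns.comp hσ.tendsto_atTop
    rw [ENNReal.tendsto_nhds_zero]
    intro ε hε
    obtain ⟨r, hr0, hrε⟩ : ∃ r : ℝ, 0 < r ∧ ENNReal.ofReal r ≤ ε := by
      rcases eq_or_ne ε ⊤ with rfl | hne
      · exact ⟨1, one_pos, le_top⟩
      · exact ⟨ε.toReal, ENNReal.toReal_pos hε.ne' hne, ENNReal.ofReal_toReal_le⟩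
    obtain ⟨N, hN⟩ := hc r hr0
    filter_upwards [eventually_ge_atTop N] with j hj
    refine le_trans ?_ hrε
    have hF := Lp.eLpNorm_lim_le_liminf_eLpNorm (μ := μ) (p := 2)
      (f := fun j' x => h (ns (σ j)) x - h (ns (σ j')) x)
      (fun j' => ((hmeas _).sub (hmeas _)).aestronglyMeasurable) (h (ns (σ j))) (by
        filter_upwards [hae] with x hx
        have := ((hpt x hx.1 hx.2).comp hto).const_sub (h (ns (σ j)) x)
        simpa using this)
    refine hF.trans ?_
    refine liminf_le_of_frequently_le' (Eventually.frequently ?_)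
    filter_upwards [eventually_ge_atTop N] with j' hj'
    exact hN j hj j' hj'
  have main : Tendsto (fun n => Λ n * (μ (Set.Icc (1 - 1 / Λ n) 1)).toReal)
      atTop (nhds 0) := by
    have k2 : Tendsto (fun n => 16 * (eLpNorm (h n) 2 μ).toReal ^ 2) atTop (nhds 0) := by
      have := (((ENNReal.tendsto_toReal ENNReal.zero_ne_top).comp key).pow 2).const_mul 16
      simpa using this
    refine tendsto_of_tendsto_of_tendsto_of_le_of_le' tendsto_const_nhds k2
      (Eventually.of_forall fun n => mul_nonneg (hpos n).le ENNReal.toReal_nonneg) ?_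
    filter_upwards [hΛ.eventually_ge_atTop 2] with n hn
    have h1 := aux_low (μ := μ) (f := h n) (S := Set.Icc (1 - 1 / Λ n) 1) measurableSet_Icc
      (ENNReal.ofReal (√(Λ n) * (1 / 4))) (by
        intro x hx
        have hq := aux_quarter _ hn x hx.1
        have h0 : √(Λ n) * (1 / 4) ≤ h n x :=
          mul_le_mul_of_nonneg_left hq (Real.sqrt_nonneg _)
        rw [Real.enorm_of_nonneg (le_trans (by positivity) h0)]
        exact ENNReal.ofReal_le_ofReal h0)
    have h2 : eLpNorm (h n) 2 μ ≤ ENNReal.ofReal C :=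
      (hbd _ (hspan n)).trans (mul_le_of_le_one_right' (hle n))
    have hfin : eLpNorm (h n) 2 μ ≠ ⊤ := ne_top_of_le_ne_top ENNReal.ofReal_ne_top h2
    have h4 := ENNReal.toReal_mono (ENNReal.pow_ne_top hfin) h1
    rw [ENNReal.toReal_mul, ENNReal.toReal_pow, ENNReal.toReal_pow,
      ENNReal.toReal_ofReal (by positivity), mul_pow, Real.sq_sqrt (hpos n).le] at h4
    linarith
  refine ⟨fun ε hε => ?_, main⟩
  have hδ : Tendsto (fun n => 1 / Λ n) atTop (nhdsWithin 0 (Set.Ioi 0)) :=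
    tendsto_nhdsWithin_iff.2 ⟨hsum.tendsto_atTop_zero,
      Eventually.of_forall fun k => one_div_pos.2 (hpos k)⟩
  refine hδ.frequently (Eventually.frequently ?_)
  filter_upwards [main.eventually_lt_const hε] with n hn
  rw [div_div_eq_mul_div, div_one, mul_comm]
  exact hn
end

section
/- Let φ : [0,1] → [0,1] be Borel measurable and μ = φ*m the pushforward of Lebesgue measure m under φ. Suppose x₀ ∈ (0,1], φ(x₀) = 1, and for some η > 0 there exists ε > 0 such that x₀ − x > (1 − φ(x))/η for every x ∈ [0,1] with 0 < x₀ − x < ε. Then μ([1−δ,1]) ≥ δ/η for every δ with 0 < δ < η·min(ε, x₀). -/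
open MeasureTheory

/-- Let `φ : [0,1] → [0,1]` be Borel measurable, `μ = φ*m`, and
suppose `x₀ ∈ (0,1]`, `φ(x₀) = 1`, and for some `η > 0` there is `ε > 0` with
`x₀ − x > (1 − φ(x))/η` whenever `0 < x₀ − x < ε`. Then `μ([1−δ,1]) ≥ δ/η` for every
`0 < δ < η·min(ε, x₀)`. -/
theorem pushforward_measure_near_one_lower_bound
    (φ : ℝ → ℝ) (hmeas : Measurable φ)
    (hmaps : Set.MapsTo φ (Set.Icc (0 : ℝ) 1) (Set.Icc (0 : ℝ) 1))
    (x₀ : ℝ) (hx₀ : x₀ ∈ Set.Ioc (0 : ℝ) 1) (hφx₀ : φ x₀ = 1)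
    (η : ℝ) (hη : 0 < η) (ε : ℝ) (hε : 0 < ε)
    (hcond : ∀ x ∈ Set.Icc (0 : ℝ) 1, 0 < x₀ - x → x₀ - x < ε →
      x₀ - x > (1 - φ x) / η) :
    ∀ δ : ℝ, 0 < δ → δ < η * min ε x₀ →
      ENNReal.ofReal (δ / η) ≤ (Measure.map φ m01) (Set.Icc (1 - δ) 1) := by
  intro δ hδ hlt
  have h1 : δ / η < min ε x₀ := by
    rw [div_lt_iff₀ hη]; linarith [mul_comm η (min ε x₀)]
  have h2 := lt_of_lt_of_le h1 (min_le_left _ _)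
  have h3 := lt_of_lt_of_le h1 (min_le_right _ _)
  rw [Measure.map_apply hmeas measurableSet_Icc, m01,
    Measure.restrict_apply (hmeas measurableSet_Icc)]
  have hv : volume (Set.Ico (x₀ - δ / η) x₀) = ENNReal.ofReal (δ / η) := by
    rw [Real.volume_Ico]; congr 1; ring
  rw [← hv]
  apply measure_mono
  rintro x ⟨hx1, hx2⟩
  have hx : x ∈ Set.Icc (0 : ℝ) 1 := ⟨by linarith, by linarith [hx₀.2]⟩
  refine ⟨⟨?_, (hmaps hx).2⟩, hx⟩
  have h4 := hcond x hx (by linarith) (by linarith)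
  have h5 : (1 - φ x) / η < δ / η := by linarith
  have h6 := (div_lt_div_iff_of_pos_right hη).1 h5
  linarith
end

section
/- Let Λ = (λ_k)_{k≥1} be a strictly increasing sequence of positive reals with ∑_k 1/λ_k < ∞, and let φ : [0,1] → [0,1] be Borel measurable with φ(x₀) = 1 for some x₀ ∈ [0,1]. If C_φ : M²_Λ → L²([0,1]) is bounded, i.e. there exists C > 0 with ‖g∘φ‖_{L²} ≤ C‖g‖_{L²} for every g in the linear span of the monomials x ↦ x^{λ_k}, then: if x₀ > 0 then limsup_{t→x₀⁻} (1 − φ(t))/(x₀ − t) > 0, and if x₀ < 1 then limsup_{t→x₀⁺} (1 − φ(t))/(t − x₀) > 0. -/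
open MeasureTheory Filter

lemma norm_mono (l : ℝ) (hl : 0 < l) :
    eLpNorm (fun x : ℝ => x ^ l) 2 m01 ^ 2 = ENNReal.ofReal (1 / (2 * l + 1)) := by
  have h1 : eLpNorm (fun x : ℝ => x ^ l) 2 m01 ^ 2 = ∫⁻ x, ‖x ^ l‖ₑ ^ (2:ℝ) ∂m01 := by
    have := eLpNorm_nnreal_pow_eq_lintegral (μ := m01) (f := fun x : ℝ => x ^ l) (p := 2)
      (by norm_num)
    simpa using this
  have h2 : ∫⁻ x, ‖x ^ l‖ₑ ^ (2:ℝ) ∂m01 = ∫⁻ x, ENNReal.ofReal (x ^ (2 * l)) ∂m01 := by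
    unfold m01
    apply setLIntegral_congr_fun measurableSet_Icc
    intro x hx
    have hx0 : 0 ≤ x := hx.1
    have h3 : 0 ≤ x ^ l := Real.rpow_nonneg hx0 l
    simp only
    rw [Real.enorm_of_nonneg h3, ENNReal.ofReal_rpow_of_nonneg h3 (by norm_num),
      ← Real.rpow_mul hx0, mul_comm]
  have hi : IntervalIntegrable (fun x : ℝ => x ^ (2 * l)) volume 0 1 :=
    intervalIntegral.intervalIntegrable_rpow' (by linarith)
  rw [h1, h2, m01, ← ofReal_integral_eq_lintegral_ofReal]
  · rw [integral_Icc_eq_integral_Ioc, ← intervalIntegral.integral_of_le zero_le_one,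
      integral_rpow (Or.inl (by linarith)), Real.one_rpow, Real.zero_rpow (by linarith), sub_zero]
  · exact (intervalIntegrable_iff_integrableOn_Icc_of_le zero_le_one).1 hi
  · filter_upwards [ae_restrict_mem measurableSet_Icc] with x hx
    exact Real.rpow_nonneg hx.1 _

lemma core (l : ℝ) (hl : 0 < l) (φ : ℝ → ℝ) (hmeas : Measurable φ) (C : ℝ) (hC : 0 < C)
    (h : eLpNorm (fun x => φ x ^ l) 2 m01 ≤
      ENNReal.ofReal C * eLpNorm (fun x : ℝ => x ^ l) 2 m01)
    (a b : ℝ) (hab : Set.Ioo a b ⊆ Set.Icc 0 1) (hφ : ∀ t ∈ Set.Ioo a b, 1 / 2 ≤ φ t ^ l) :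
    b - a ≤ 4 * C ^ 2 / (2 * l + 1) := by
  have h1 := mul_meas_ge_le_pow_eLpNorm' (μ := m01) (f := fun x => φ x ^ l) (p := 2)
    (by norm_num) (by norm_num) (hmeas.pow_const l).aestronglyMeasurable (ENNReal.ofReal (1/2))
  have h2 : ENNReal.ofReal (b - a) ≤
      m01 {x | ENNReal.ofReal (1/2) ≤ ‖φ x ^ l‖ₑ} := by
    have : ENNReal.ofReal (b - a) = m01 (Set.Ioo a b) := by
      rw [m01, Measure.restrict_apply measurableSet_Ioo, Set.inter_eq_left.2 hab, Real.volume_Ioo]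
    rw [this]
    apply measure_mono
    intro t ht
    have h3 := hφ t ht
    simp only [Set.mem_setOf_eq]
    rw [Real.enorm_of_nonneg (by linarith)]
    exact ENNReal.ofReal_le_ofReal h3
  have h3 : ENNReal.ofReal ((1/2)^2 * (b - a)) ≤ ENNReal.ofReal (C ^ 2 * (1 / (2 * l + 1))) := by
    rw [ENNReal.ofReal_mul (by positivity), ENNReal.ofReal_mul (by positivity),
      ← norm_mono l hl, ENNReal.ofReal_pow (by norm_num), ENNReal.ofReal_pow hC.le, ← mul_pow]
    refine le_trans (mul_le_mul_right h2 _) (le_trans ?_ (pow_le_pow_left₀ (zero_le) h 2))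
    simpa using h1
  rw [ENNReal.ofReal_le_ofReal_iff (by positivity)] at h3
  have : 4 * C ^ 2 / (2 * l + 1) = 4 * (C ^ 2 * (1 / (2 * l + 1))) := by ring
  rw [this]; linarith

lemma half_le (l C s p : ℝ) (hl : 1 ≤ l) (hC : 0 < C) (hs : s < 2 * C ^ 2 / l)
    (hp : 1 - 1 / (4 * C ^ 2) * s ≤ p) : 1 / 2 ≤ p ^ l := by
  have h0 : 1 / (4 * C ^ 2) * s ≤ 1 / (2 * l) := by
    have : 1 / (2 * l) = 1 / (4 * C ^ 2) * (2 * C ^ 2 / l) := by field_simp; norm_num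
    rw [this]; gcongr
  have h1 : 1 / (2 * l) ≤ 1 := by rw [div_le_one (by linarith)]; linarith
  have h2 := one_add_mul_self_le_rpow_one_add (s := - (1 / (2 * l))) (by linarith) hl
  have h3 : (1 + - (1 / (2 * l))) ^ l ≤ p ^ l :=
    Real.rpow_le_rpow (by linarith) (by linarith) (by linarith)
  have h4 : 1 + l * -(1 / (2 * l)) = 1 / 2 := by field_simp; norm_num
  linarith

lemma final_lt (l C : ℝ) (hl : 1 ≤ l) (hC : 0 < C) :
    4 * C ^ 2 / (2 * l + 1) < 2 * C ^ 2 / l := by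
  rw [div_lt_div_iff₀ (by linarith) (by linarith)]
  nlinarith [pow_pos hC 2]

/-- Let `Λ` be strictly increasing positive with `∑ 1/λ_k < ∞` and
`φ : [0,1] → [0,1]` Borel measurable with `φ(x₀) = 1`. If the composition operator
`C_φ : M²_Λ → L²` is bounded, then the upper left Dini derivative of `φ` at `x₀` is
positive (if `x₀ > 0`) and the lower right Dini derivative is negative (if `x₀ < 1`):
`limsup_{t→x₀⁻} (1−φ(t))/(x₀−t) > 0` and `limsup_{t→x₀⁺} (1−φ(t))/(t−x₀) > 0`. -/
theorem composition_bounded_dini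
    (Λ : ℕ → ℝ) (hmono : StrictMono Λ) (hpos : ∀ k, 0 < Λ k)
    (hsum : Summable fun k => 1 / Λ k)
    (φ : ℝ → ℝ) (hmeas : Measurable φ)
    (hmaps : Set.MapsTo φ (Set.Icc (0 : ℝ) 1) (Set.Icc (0 : ℝ) 1))
    (x₀ : ℝ) (hx₀ : x₀ ∈ Set.Icc (0 : ℝ) 1) (hφx₀ : φ x₀ = 1)
    (C : ℝ) (hC : 0 < C)
    (hbd : ∀ g : ℝ → ℝ, inSpan Λ g →
      eLpNorm (fun x => g (φ x)) 2 m01 ≤ ENNReal.ofReal C * eLpNorm g 2 m01) :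
    (0 < x₀ → ∃ M : ℝ, 0 < M ∧
      ∃ᶠ t in nhdsWithin x₀ (Set.Ico 0 x₀), M ≤ (1 - φ t) / (x₀ - t)) ∧
    (x₀ < 1 → ∃ M : ℝ, 0 < M ∧
      ∃ᶠ t in nhdsWithin x₀ (Set.Ioc x₀ 1), M ≤ (1 - φ t) / (t - x₀)) := by
  have htop : Tendsto Λ atTop atTop := by
    have h := hsum.tendsto_atTop_zero
    have h2 : Tendsto (fun k => 1 / Λ k) atTop (nhdsWithin 0 (Set.Ioi 0)) :=
      tendsto_nhdsWithin_iff.2 ⟨h, Eventually.of_forall fun k => one_div_pos.2 (hpos k)⟩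
    refine h2.inv_tendsto_nhdsGT_zero.congr fun k => ?_
    simp
  have hbd' : ∀ k, eLpNorm (fun x => φ x ^ Λ k) 2 m01 ≤
      ENNReal.ofReal C * eLpNorm (fun x : ℝ => x ^ Λ k) 2 m01 := fun k =>
    hbd (fun x => x ^ Λ k) ⟨1, fun _ => 1, fun _ => k, fun x => by simp⟩
  have hex : ∀ δ : ℝ, 0 < δ → ∃ k, 1 ≤ Λ k ∧ 2 * C ^ 2 / Λ k ≤ δ := by
    intro δ hδ
    obtain ⟨k, h1, h2⟩ := ((htop.eventually_ge_atTop 1).and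
      (htop.eventually_ge_atTop (2 * C ^ 2 / δ))).exists
    refine ⟨k, h1, ?_⟩
    rw [div_le_iff₀ hδ] at h2
    rw [div_le_iff₀ (hpos k)]
    linarith
  have hM : 0 < 1 / (4 * C ^ 2) := by positivity
  constructor
  · intro hx
    refine ⟨1 / (4 * C ^ 2), hM, fun hcon => ?_⟩
    obtain ⟨δ, hδ, hδ'⟩ := Metric.mem_nhdsWithin_iff.1 hcon
    obtain ⟨k, hk1, hk2⟩ := hex (min δ x₀) (lt_min hδ hx)
    have hk3 := hk2.trans (min_le_left _ _)
    have hk4 := hk2.trans (min_le_right _ _)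
    have := core (Λ k) (hpos k) φ hmeas C hC (hbd' k) (x₀ - 2 * C ^ 2 / Λ k) x₀
      (fun t ht => ⟨by linarith [ht.1], by linarith [ht.2, hx₀.2]⟩) (fun t ht => by
        have ht1 := ht.1
        have ht2 := ht.2
        have h5 : t ∈ {t | ¬ (1 / (4 * C ^ 2) ≤ (1 - φ t) / (x₀ - t))} := hδ' ⟨by
          rw [Metric.mem_ball, Real.dist_eq, abs_lt]; constructor <;> linarith,
          by linarith, ht2⟩
        have h6 := not_le.1 h5
        rw [div_lt_iff₀ (by linarith)] at h6
        exact half_le (Λ k) C (x₀ - t) (φ t) hk1 hC (by linarith) (by linarith))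
    linarith [final_lt (Λ k) C hk1 hC]
  · intro hx
    refine ⟨1 / (4 * C ^ 2), hM, fun hcon => ?_⟩
    obtain ⟨δ, hδ, hδ'⟩ := Metric.mem_nhdsWithin_iff.1 hcon
    obtain ⟨k, hk1, hk2⟩ := hex (min δ (1 - x₀)) (lt_min hδ (by linarith))
    have hk3 := hk2.trans (min_le_left _ _)
    have hk4 := hk2.trans (min_le_right _ _)
    have := core (Λ k) (hpos k) φ hmeas C hC (hbd' k) x₀ (x₀ + 2 * C ^ 2 / Λ k)
      (fun t ht => ⟨by linarith [ht.1, hx₀.1], by linarith [ht.2]⟩) (fun t ht => by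
        have ht1 := ht.1
        have ht2 := ht.2
        have h5 : t ∈ {t | ¬ (1 / (4 * C ^ 2) ≤ (1 - φ t) / (t - x₀))} := hδ' ⟨by
          rw [Metric.mem_ball, Real.dist_eq, abs_lt]; constructor <;> linarith,
          ht1, by linarith⟩
        have h6 := not_le.1 h5
        rw [div_lt_iff₀ (by linarith)] at h6
        exact half_le (Λ k) C (t - x₀) (φ t) hk1 hC (by linarith) (by linarith))
    linarith [final_lt (Λ k) C hk1 hC]
end

section
/- Let Λ = (λ_k)_{k≥1} be a strictly increasing sequence of positive reals with ∑_k 1/λ_k < ∞, and let φ be a polynomial with real coefficients satisfying φ([0,1]) ⊆ [0,1] and φ(x₀) = 1 for some x₀ ∈ [0,1]. Then C_φ : M²_Λ → L²([0,1]) is not compact (there is no constant C and no way that every sequence (g_n) in the span of the monomials with ‖g_n‖_{L²} ≤ 1, ‖g_n∘φ‖_{L²} ≤ C, has a subsequence with (g_{n_j}∘φ) Cauchy in L²). Moreover, if C_φ is bounded on the span of the monomials, then every x ∈ [0,1] with φ(x) = 1 satisfies x ∈ {0, 1}. -/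
open MeasureTheory Filter

/-- `C_φ : M²_Λ → L²` is bounded on the span of the monomials. -/
def compBounded (Λ : ℕ → ℝ) (φ : ℝ → ℝ) : Prop :=
  ∃ C : ℝ, 0 < C ∧ ∀ g : ℝ → ℝ, inSpan Λ g →
    eLpNorm (fun x => g (φ x)) 2 m01 ≤ ENNReal.ofReal C * eLpNorm g 2 m01

/-- Every sequence in the span of the monomials with `L²` norm at most `1` admits a
subsequence whose composition with `φ` is Cauchy in `L²([0,1])`. -/
def compSubseqCauchy (Λ : ℕ → ℝ) (φ : ℝ → ℝ) : Prop :=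
  ∀ g : ℕ → ℝ → ℝ, (∀ n, inSpan Λ (g n)) →
    (∀ n, eLpNorm (g n) 2 m01 ≤ 1) →
    ∃ σ : ℕ → ℕ, StrictMono σ ∧
      ∀ ε : ℝ, 0 < ε → ∃ N : ℕ, ∀ j ≥ N, ∀ j' ≥ N,
        eLpNorm (fun x => g (σ j) (φ x) - g (σ j') (φ x)) 2 m01 ≤
          ENNReal.ofReal ε


lemma gnorm (p : ℝ) (hp : 0 < p) :
    eLpNorm (fun x : ℝ => Real.sqrt (2 * p + 1) * x ^ p) 2 m01 ≤ 1 := by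
  have h1 : eLpNorm (fun x : ℝ => Real.sqrt (2 * p + 1) * x ^ p) 2 m01 ^ 2 ≤ 1 := by
    have e := eLpNorm_nnreal_pow_eq_lintegral (p := 2) (μ := m01)
      (f := fun x : ℝ => Real.sqrt (2 * p + 1) * x ^ p) (by norm_num)
    simp only [NNReal.coe_ofNat, ENNReal.coe_ofNat, ENNReal.rpow_ofNat] at e
    rw [e]
    have e2 : ∫⁻ x, ‖Real.sqrt (2 * p + 1) * x ^ p‖ₑ ^ 2 ∂m01
        = ∫⁻ x in Set.Icc (0 : ℝ) 1, ENNReal.ofReal ((2 * p + 1) * x ^ (2 * p)) := by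
      unfold m01
      refine setLIntegral_congr_fun measurableSet_Icc ?_
      intro x hx
      have hx0 : 0 ≤ x := hx.1
      simp only
      rw [Real.enorm_eq_ofReal (by positivity), ← ENNReal.ofReal_pow (by positivity)]
      congr 1
      rw [mul_pow, Real.sq_sqrt (by positivity), mul_comm 2 p, Real.rpow_mul hx0]
      simp
    rw [e2, ← ofReal_integral_eq_lintegral_ofReal]
    · rw [integral_Icc_eq_integral_Ioc, ← intervalIntegral.integral_of_le zero_le_one,
        intervalIntegral.integral_const_mul, integral_rpow (Or.inl (by linarith))]
      rw [Real.one_rpow, Real.zero_rpow (by positivity)]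
      have : (2 * p + 1) * ((1 - 0) / (2 * p + 1)) = 1 := by field_simp; simp
      rw [this]; simp
    · apply ContinuousOn.integrableOn_Icc
      have : Continuous fun x : ℝ => x ^ (2 * p) := Real.continuous_rpow_const (by positivity)
      fun_prop
    · refine (ae_restrict_iff' measurableSet_Icc).2 (Eventually.of_forall ?_)
      intro x hx
      have hx0 : 0 ≤ x := hx.1
      simp only [Pi.zero_apply]
      positivity
  by_contra h
  push Not at h
  exact absurd h1 (not_le.2 (one_lt_pow₀ h (by norm_num)))

lemma lower (φ : ℝ → ℝ) (p δ x : ℝ) (hp : 1 ≤ p) (hδ0 : 0 < δ) (hδ : δ ≤ 1 / 2)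
    (hx : x ∈ Set.Icc (0 : ℝ) 1) (hc : Continuous φ)
    (hl : ∀ y ∈ Set.Icc (0 : ℝ) 1, |y - x| ≤ δ → 1 - 1 / (2 * p) ≤ φ y) :
    ENNReal.ofReal (p * δ / 2) ≤
      eLpNorm (fun y => Real.sqrt (2 * p + 1) * (φ y) ^ p) 2 m01 ^ 2 := by
  have hm : AEStronglyMeasurable (fun y => Real.sqrt (2 * p + 1) * (φ y) ^ p) m01 := by
    have : Continuous fun x : ℝ => x ^ p := Real.continuous_rpow_const (by positivity)
    have := this.comp hc
    exact (continuous_const.mul this).aestronglyMeasurable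
  have hs : ∃ a, ∀ y ∈ Set.Icc a (a + δ), y ∈ Set.Icc (0 : ℝ) 1 ∧ |y - x| ≤ δ := by
    obtain ⟨h0, h1⟩ := hx
    rcases le_total x (1 / 2) with h | h
    · refine ⟨x, fun y hy => ?_⟩
      obtain ⟨ha, hb⟩ := hy
      exact ⟨⟨by linarith, by linarith⟩, abs_le.2 ⟨by linarith, by linarith⟩⟩
    · refine ⟨x - δ, fun y hy => ?_⟩
      obtain ⟨ha, hb⟩ := hy
      exact ⟨⟨by linarith, by linarith⟩, abs_le.2 ⟨by linarith, by linarith⟩⟩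
  obtain ⟨a, ha⟩ := hs
  have key := mul_meas_ge_le_pow_eLpNorm' m01 (p := 2) (by norm_num) (by norm_num) hm
    (ENNReal.ofReal (Real.sqrt (2 * p + 1) / 2))
  simp only [ENNReal.toReal_ofNat, ENNReal.rpow_ofNat] at key
  refine le_trans ?_ key
  have hmeas : ENNReal.ofReal δ ≤ m01 {y | ENNReal.ofReal (Real.sqrt (2 * p + 1) / 2)
      ≤ ‖Real.sqrt (2 * p + 1) * (φ y) ^ p‖ₑ} := by
    have e : ENNReal.ofReal δ = m01 (Set.Icc a (a + δ)) := by
      unfold m01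
      rw [Measure.restrict_apply measurableSet_Icc, Set.inter_eq_left.2 (fun y hy => (ha y hy).1),
        Real.volume_Icc]
      congr 1; ring
    rw [e]
    apply measure_mono
    intro y hy
    obtain ⟨hy1, hy2⟩ := ha y hy
    have h3 := hl y hy1 hy2
    have hp0 : 0 < p := by linarith
    have h4 : 0 ≤ 1 - 1 / (2 * p) := by
      rw [sub_nonneg, div_le_one (by positivity)]; linarith
    have h5 : 1 / 2 ≤ (φ y) ^ p := by
      have b := one_add_mul_self_le_rpow_one_add (s := -(1 / (2 * p))) (by linarith) hp
      have b2 : 1 + p * -(1 / (2 * p)) = 1 / 2 := by field_simp; norm_num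
      rw [b2, ← sub_eq_add_neg] at b
      exact b.trans (Real.rpow_le_rpow h4 h3 hp0.le)
    simp only [Set.mem_setOf_eq]
    rw [Real.enorm_eq_ofReal (by positivity)]
    apply ENNReal.ofReal_le_ofReal
    have : 0 ≤ Real.sqrt (2 * p + 1) := Real.sqrt_nonneg _
    nlinarith
  calc ENNReal.ofReal (p * δ / 2) ≤ ENNReal.ofReal (Real.sqrt (2 * p + 1) / 2) ^ 2 *
        ENNReal.ofReal δ := by
        rw [← ENNReal.ofReal_pow (by positivity), ← ENNReal.ofReal_mul (by positivity)]
        apply ENNReal.ofReal_le_ofReal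
        rw [div_pow, Real.sq_sqrt (by linarith)]
        nlinarith
    _ ≤ _ := by gcongr

lemma lip (P : Polynomial ℝ) (x : ℝ) :
    ∃ L : ℝ, 1 ≤ L ∧ ∀ y ∈ Set.Icc (0 : ℝ) 1, |P.eval y| ≤ L := by
  obtain ⟨C, hC⟩ := isCompact_Icc.exists_bound_of_continuousOn
    (s := Set.Icc (0 : ℝ) 1) (f := fun y => P.eval y) (P.continuous.continuousOn)
  exact ⟨max 1 C, le_max_left _ _, fun y hy => (hC y hy).trans (le_max_right _ _)⟩

lemma inSp (Λ : ℕ → ℝ) (s : ℝ) (n : ℕ) : inSpan Λ (fun x => s * x ^ (Λ n)) :=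
  ⟨1, fun _ => s, fun _ => n, fun x => by simp⟩

lemma tlim (Λ : ℕ → ℝ) (hpos : ∀ k, 0 < Λ k) (hΛ : Tendsto Λ atTop atTop) (t : ℝ)
    (h0 : 0 ≤ t) (h1 : t < 1) :
    Tendsto (fun n => Real.sqrt (2 * Λ n + 1) * t ^ (Λ n)) atTop (nhds 0) := by
  rcases h0.eq_or_lt with rfl | h0
  · simp [Real.zero_rpow (hpos _).ne']
  have hb : 0 < - Real.log t := by have := Real.log_neg h0 h1; linarith
  have a1 := tendsto_rpow_mul_exp_neg_mul_atTop_nhds_zero 1 _ hb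
  have a0 := tendsto_rpow_mul_exp_neg_mul_atTop_nhds_zero 0 _ hb
  have a := (a1.add a0).comp hΛ
  rw [add_zero] at a
  refine squeeze_zero (fun n => by positivity) (fun n => ?_) a
  have hp := hpos n
  have e : t ^ (Λ n) = Real.exp (- -Real.log t * Λ n) := by
    rw [Real.rpow_def_of_pos h0]; simp
  simp only [Function.comp, Real.rpow_one, Real.rpow_zero]
  rw [← e, ← add_mul]
  gcongr
  rw [Real.sqrt_le_left (by linarith)]
  nlinarith

lemma part2 (Λ : ℕ → ℝ) (hpos : ∀ k, 0 < Λ k) (hΛ : Tendsto Λ atTop atTop)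
    (P : Polynomial ℝ) (φ : ℝ → ℝ) (hφ : ∀ x, φ x = P.eval x)
    (hmaps : Set.MapsTo φ (Set.Icc (0 : ℝ) 1) (Set.Icc (0 : ℝ) 1))
    (hb : compBounded Λ φ) (x : ℝ) (hx : x ∈ Set.Icc (0 : ℝ) 1) (h1 : φ x = 1) :
    x = 0 ∨ x = 1 := by
  by_contra hne
  push Not at hne
  have hxo : x ∈ Set.Ioo (0 : ℝ) 1 :=
    ⟨lt_of_le_of_ne hx.1 hne.1.symm, lt_of_le_of_ne hx.2 hne.2⟩
  have hmax : IsLocalMax (fun y => P.eval y) x := by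
    filter_upwards [Icc_mem_nhds hxo.1 hxo.2] with y hy
    have := (hmaps hy).2
    rw [hφ] at this h1
    linarith
  have hd : P.derivative.eval x = 0 := hmax.hasDerivAt_eq_zero (P.hasDerivAt x)
  obtain ⟨Q, hQ⟩ : (Polynomial.X - Polynomial.C x) ∣ P - 1 := by
    rw [Polynomial.dvd_iff_isRoot]; simp [← hφ, h1]
  have hQx : Q.eval x = 0 := by
    have := congrArg (fun R => (Polynomial.derivative R).eval x) hQ
    simp at this
    linarith
  obtain ⟨R, hR⟩ : (Polynomial.X - Polynomial.C x) ∣ Q := by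
    rw [Polynomial.dvd_iff_isRoot]; exact hQx
  have hP : ∀ y, φ y = 1 + (y - x) ^ 2 * R.eval y := by
    intro y
    have := congrArg (fun R => R.eval y) hQ
    simp [hR] at this
    rw [hφ]; linarith
  obtain ⟨K, hK1, hK⟩ := lip R x
  obtain ⟨C, hC, hB⟩ := hb
  obtain ⟨n, hn1, hn2⟩ := ((hΛ.eventually_ge_atTop 1).and
    (hΛ.eventually_gt_atTop (16 * K * C ^ 4))).exists
  set p := Λ n with hp
  have hs : 0 < Real.sqrt (4 * K * p) := by positivity
  have hs2 : Real.sqrt (4 * K * p) ^ 2 = 4 * K * p := Real.sq_sqrt (by positivity)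
  set δ := 1 / Real.sqrt (4 * K * p) with hδ
  have hδ2 : δ ^ 2 = 1 / (4 * K * p) := by rw [hδ, div_pow, hs2]; simp
  have hδ0 : 0 < δ := by positivity
  have hKp : 1 ≤ K * p := by nlinarith
  have low := lower φ p δ x hn1 hδ0 (by
      have : δ ^ 2 ≤ (1 / 2) ^ 2 := by
        rw [hδ2, div_le_iff₀ (by positivity)]; nlinarith
      nlinarith) hx (by rw [funext hφ]; exact P.continuous) (by
      intro y hy hyx
      have hk := (abs_le.1 (hK y hy)).1
      have h2 : (y - x) ^ 2 ≤ δ ^ 2 := by rw [← sq_abs]; gcongr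
      have h3 : δ ^ 2 * K ≤ 1 / (2 * p) := by
        rw [hδ2, div_mul_eq_mul_div, div_le_div_iff₀ (by positivity) (by positivity)]
        nlinarith
      rw [hP]
      nlinarith [sq_nonneg (y - x)])
  have up := hB _ (inSp Λ (Real.sqrt (2 * p + 1)) n)
  have up2 : eLpNorm (fun y => Real.sqrt (2 * p + 1) * (φ y) ^ p) 2 m01 ≤ ENNReal.ofReal C :=
    up.trans ((mul_le_mul_right (gnorm p (hpos n)) _).trans (by simp))
  have fin : ENNReal.ofReal (p * δ / 2) ≤ ENNReal.ofReal (C ^ 2) := by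
    refine low.trans ?_
    rw [ENNReal.ofReal_pow hC.le]
    gcongr
  rw [ENNReal.ofReal_le_ofReal_iff (by positivity)] at fin
  have f2 : (p * δ / 2) ^ 2 ≤ (C ^ 2) ^ 2 := by
    have : 0 ≤ p * δ / 2 := by positivity
    gcongr
  have f3 : (p * δ / 2) ^ 2 = p / (16 * K) := by
    rw [div_pow, mul_pow, hδ2]; field_simp; norm_num
  rw [f3, div_le_iff₀ (by positivity)] at f2
  nlinarith

/-- Let `Λ` be strictly increasing positive with `∑ 1/λ_k < ∞`, and
let `φ` be a real polynomial with `φ([0,1]) ⊆ [0,1]` and `φ(x₀) = 1` for some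
`x₀ ∈ [0,1]`. Then `C_φ : M²_Λ → L²` is not compact, and if it is bounded then every
point of `[0,1]` where `φ` takes the value `1` is an endpoint `0` or `1`. -/
theorem polynomial_composition_not_compact
    (Λ : ℕ → ℝ) (hmono : StrictMono Λ) (hpos : ∀ k, 0 < Λ k)
    (hsum : Summable fun k => 1 / Λ k)
    (P : Polynomial ℝ) (φ : ℝ → ℝ) (hφ : ∀ x, φ x = P.eval x)
    (hmaps : Set.MapsTo φ (Set.Icc (0 : ℝ) 1) (Set.Icc (0 : ℝ) 1))
    (x₀ : ℝ) (hx₀ : x₀ ∈ Set.Icc (0 : ℝ) 1) (hφx₀ : φ x₀ = 1) :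
    ¬ (compBounded Λ φ ∧ compSubseqCauchy Λ φ) ∧
    (compBounded Λ φ →
      ∀ x ∈ Set.Icc (0 : ℝ) 1, φ x = 1 → x = 0 ∨ x = 1) := by
  have hΛ : Tendsto Λ atTop atTop := by
    have h := hsum.tendsto_atTop_zero
    have h2 : Tendsto (fun k => 1 / Λ k) atTop (nhdsWithin 0 (Set.Ioi 0)) :=
      tendsto_nhdsWithin_iff.2 ⟨h, Eventually.of_forall fun k => by
        have := hpos k
        simp only [Set.mem_Ioi]; positivity⟩
    have h3 := h2.inv_tendsto_nhdsGT_zero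
    refine h3.congr fun k => by simp
  have hc : Continuous φ := by rw [funext hφ]; exact P.continuous
  refine ⟨?_, part2 Λ hpos hΛ P φ hφ hmaps⟩
  rintro ⟨hb, hcpt⟩
  have hP1 : P - 1 ≠ 0 := by
    intro h
    have hP : P = 1 := sub_eq_zero.1 h
    have := part2 Λ hpos hΛ P φ hφ hmaps hb (1 / 2) ⟨by norm_num, by norm_num⟩
      (by rw [hφ, hP]; simp)
    norm_num at this
  obtain ⟨Q, hQ⟩ : (Polynomial.X - Polynomial.C x₀) ∣ P - 1 := by
    rw [Polynomial.dvd_iff_isRoot]; simp [← hφ, hφx₀]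
  have hP : ∀ y, φ y = 1 + (y - x₀) * Q.eval y := by
    intro y
    have := congrArg (fun R => R.eval y) hQ
    simp at this
    rw [hφ]; linarith
  obtain ⟨L, hL1, hL⟩ := lip Q x₀
  obtain ⟨σ, hσ, hcau⟩ := hcpt (fun n x => Real.sqrt (2 * Λ n + 1) * x ^ (Λ n))
    (fun n => inSp Λ _ n) (fun n => gnorm _ (hpos n))
  obtain ⟨N, hN⟩ := hcau (1 / (4 * L)) (by positivity)
  obtain ⟨j, hj, hj1⟩ := ((eventually_ge_atTop N).and
    ((hΛ.comp hσ.tendsto_atTop).eventually_ge_atTop 1)).exists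
  simp only [Function.comp] at hj1
  have hcont : ∀ n, Continuous fun y => Real.sqrt (2 * Λ n + 1) * (φ y) ^ (Λ n) := fun n =>
    continuous_const.mul ((Real.continuous_rpow_const (hpos n).le).comp hc)
  have hae : ∀ᵐ y ∂m01, 0 ≤ φ y ∧ φ y < 1 := by
    have hfin : {y | (P - 1).IsRoot y}.Finite := Polynomial.finite_setOf_isRoot hP1
    have hn : ∀ᵐ y ∂m01, y ∉ {y | (P - 1).IsRoot y} := by
      apply ae_restrict_of_ae
      exact measure_eq_zero_iff_ae_notMem.1 (hfin.measure_zero _)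
    have hI : ∀ᵐ y ∂m01, y ∈ Set.Icc (0 : ℝ) 1 := ae_restrict_mem measurableSet_Icc
    filter_upwards [hn, hI] with y h1 h2
    refine ⟨(hmaps h2).1, lt_of_le_of_ne (hmaps h2).2 fun h => h1 ?_⟩
    simp [Polynomial.IsRoot, ← hφ, h]
  have hfatou := Lp.eLpNorm_lim_le_liminf_eLpNorm (p := 2) (μ := m01)
    (f := fun j' y => Real.sqrt (2 * Λ (σ j) + 1) * (φ y) ^ (Λ (σ j)) -
      Real.sqrt (2 * Λ (σ j') + 1) * (φ y) ^ (Λ (σ j')))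
    (fun j' => ((hcont _).sub (hcont _)).aestronglyMeasurable)
    (fun y => Real.sqrt (2 * Λ (σ j) + 1) * (φ y) ^ (Λ (σ j))) (by
      filter_upwards [hae] with y hy
      have := (tlim Λ hpos hΛ (φ y) hy.1 hy.2).comp hσ.tendsto_atTop
      simpa using tendsto_const_nhds.sub this)
  have hup : eLpNorm (fun y => Real.sqrt (2 * Λ (σ j) + 1) * (φ y) ^ (Λ (σ j))) 2 m01
      ≤ ENNReal.ofReal (1 / (4 * L)) := by
    refine hfatou.trans ?_
    refine liminf_le_of_frequently_le' (Eventually.frequently ?_)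
    filter_upwards [eventually_ge_atTop N] with j' hj'
    exact hN j hj j' hj'
  set p := Λ (σ j) with hp
  have low := lower φ p (1 / (2 * L * p)) x₀ hj1 (by positivity) (by
      rw [div_le_div_iff₀ (by positivity) (by positivity)]; nlinarith) hx₀ hc (by
      intro y hy hyx
      have hk := hL y hy
      have h2 : |(y - x₀) * Q.eval y| ≤ 1 / (2 * L * p) * L := by
        rw [abs_mul]; gcongr
      have h3 : 1 / (2 * L * p) * L = 1 / (2 * p) := by field_simp
      rw [hP]
      rw [h3] at h2
      linarith [(abs_le.1 h2).1])
  have fin : ENNReal.ofReal (p * (1 / (2 * L * p)) / 2) ≤ ENNReal.ofReal ((1 / (4 * L)) ^ 2) := by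
    refine low.trans ?_
    rw [ENNReal.ofReal_pow (by positivity)]
    gcongr
  rw [ENNReal.ofReal_le_ofReal_iff (by positivity)] at fin
  have e1 : p * (1 / (2 * L * p)) / 2 = 1 / (4 * L) := by field_simp; norm_num
  rw [e1] at fin
  have q0 : 0 < 1 / (4 * L) := by positivity
  have q1 : 1 / (4 * L) ≤ 1 / 4 := by
    rw [div_le_div_iff₀ (by positivity) (by positivity)]; linarith
  nlinarith
end
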